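/- arXiv:0707.3401 — 2 statements merged into one kernel-verified Lean document; each statement's English description precedes it below -/
import Mathlib

section
/- Fix τ ∈ (0,π). Let {μ_{nk}} be an infinitesimal array of probability measures on 𝕋, each with nonzero first moment, and let {λ_n}_{n≥1} ⊂ 𝕋. Then λ_n · Π_{k=1}^{k_n} B_{μ_{nk}}(z) converges to 0 uniformly on compact subsets of 𝔻 as n → ∞ (i.e., the boolean convolutions δ_{λ_n} ⨃ μ_{n1} ⨃ ⋯ ⨃ μ_{nk_n} converge weakly to Haar measure m on 𝕋) if and only if lim_{n→∞} Σ_{k=1}^{k_n} ∫_𝕋 (1−Re ζ) dμ_{nk}°(ζ) = +∞. -/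
open MeasureTheory Complex Filter Topology Metric

noncomputable section

instance : MeasurableSpace Circle := borel Circle
instance : BorelSpace Circle := ⟨rfl⟩

/-- ψ_μ(z) = ∫ ζz/(1-ζz) dμ(ζ). -/
def psiT (μ : Measure Circle) (z : ℂ) : ℂ :=
  ∫ ζ : Circle, ((ζ : ℂ) * z) / (1 - (ζ : ℂ) * z) ∂μ

/-- The B-transform of a measure on the circle:
B_μ(z) = (1/z)·ψ_μ(z)/(1+ψ_μ(z)) for z ≠ 0 and B_μ(0) = ∫ ζ dμ. -/
def BT (μ : Measure Circle) (z : ℂ) : ℂ :=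
  if z = 0 then ∫ ζ : Circle, (ζ : ℂ) ∂μ
  else z⁻¹ * (psiT μ z / (1 + psiT μ z))

/-- Infinitesimal triangular array: max_{1≤k≤k_n} μ_{nk}{|ζ-1| ≥ ε} → 0 as n → ∞. -/
def IsInfinitesimalArrayT (kn : ℕ → ℕ) (μ : ℕ → ℕ → Measure Circle) : Prop :=
  ∀ ε : ℝ, 0 < ε → ∀ δ : ENNReal, 0 < δ → ∃ N : ℕ, ∀ n ≥ N, ∀ i < kn n,
    μ n i {ζ : Circle | ε ≤ ‖(ζ : ℂ) - 1‖} < δ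

/-- β = ∫_{|arg ζ|<τ} arg ζ dμ. -/
def betaT (τ : ℝ) (μ : Measure Circle) : ℝ :=
  ∫ ζ in {ζ : Circle | |Complex.arg (ζ : ℂ)| < τ}, Complex.arg (ζ : ℂ) ∂μ

/-- b = e^{iβ} as an element of the circle. -/
def bT (τ : ℝ) (μ : Measure Circle) : Circle := Circle.exp (betaT τ μ)

/-- μ° : the centering of μ, i.e. the pushforward of μ under ζ ↦ b⁻¹ ζ. -/
def centerT (τ : ℝ) (μ : Measure Circle) : Measure Circle :=
  Measure.map (fun ζ => (bT τ μ)⁻¹ * ζ) μ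

/-- h(z) = -i ∫ Im ζ dμ° + ∫ (1+ζz)/(1-ζz)·(1-Re ζ) dμ°, for the centered measure μ°. -/
def hT (τ : ℝ) (μ : Measure Circle) (z : ℂ) : ℂ :=
  -Complex.I * ((∫ ζ : Circle, ((ζ : ℂ)).im ∂(centerT τ μ) : ℝ) : ℂ) +
    ∫ ζ : Circle, ((1 + (ζ : ℂ) * z) / (1 - (ζ : ℂ) * z)) * ((1 - ((ζ : ℂ)).re : ℝ) : ℂ)
      ∂(centerT τ μ)

lemma continuous_integrable {μ : Measure Circle} [IsFiniteMeasure μ] {E : Type*}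
    [NormedAddCommGroup E] {f : Circle → E} (hf : Continuous f) : Integrable f μ :=
  hf.integrable_of_hasCompactSupport (HasCompactSupport.of_compactSpace f)

lemma continuous_integrable_prod {μ : Measure Circle} [IsFiniteMeasure μ] {E : Type*}
    [NormedAddCommGroup E] {f : Circle × Circle → E} (hf : Continuous f) : Integrable f (μ.prod μ) :=
  hf.integrable_of_hasCompactSupport (HasCompactSupport.of_compactSpace f)

lemma one_sub_circle_mul_ne_zero {z : ℂ} (hz : ‖z‖ < 1) (x : Circle) : 1 - (x : ℂ) * z ≠ 0 := by
  intro h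
  have h1 : ‖(x : ℂ) * z‖ = 1 := by rw [← sub_eq_zero.mp h, norm_one]
  rw [norm_mul, Circle.norm_coe, one_mul] at h1
  exact hz.ne h1

lemma continuous_inv_one_sub {z : ℂ} (hz : ‖z‖ < 1) :
    Continuous fun x : Circle => (1 - (x : ℂ) * z)⁻¹ :=
  (by fun_prop : Continuous fun x : Circle => 1 - (x : ℂ) * z).inv₀ (one_sub_circle_mul_ne_zero hz)

lemma BT_eq_div (μ : Measure Circle) [IsProbabilityMeasure μ] {z : ℂ} (hz : ‖z‖ < 1) :
    BT μ z = (∫ x : Circle, (x : ℂ) * (1 - (x : ℂ) * z)⁻¹ ∂μ) /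
      ∫ x : Circle, (1 - (x : ℂ) * z)⁻¹ ∂μ := by
  by_cases h0 : z = 0
  · simp [BT, h0]
  · have hg := continuous_integrable (μ := μ) (continuous_inv_one_sub hz)
    have hpsi : psiT μ z = z * ∫ x : Circle, (x : ℂ) * (1 - (x : ℂ) * z)⁻¹ ∂μ := by
      rw [psiT, ← integral_const_mul]
      congr 1; ext x; ring
    have hden : 1 + psiT μ z = ∫ x : Circle, (1 - (x : ℂ) * z)⁻¹ ∂μ := by
      have : psiT μ z = (∫ x : Circle, (1 - (x : ℂ) * z)⁻¹ ∂μ) - ∫ _ : Circle, (1 : ℂ) ∂μ := by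
        rw [psiT, ← integral_sub hg (integrable_const _)]
        congr 1; ext x
        have := one_sub_circle_mul_ne_zero hz x
        field_simp; ring
      rw [this]; simp
    rw [BT, if_neg h0, hden, hpsi]
    field_simp

lemma norm_integral_sq_eq_integral_prod {μ : Measure Circle} [IsFiniteMeasure μ] {f : Circle → ℂ}
    (hf : Continuous f) :
    ‖∫ x, f x ∂μ‖ ^ 2 = ∫ p : Circle × Circle, (f p.1 * (starRingEnd ℂ) (f p.2)).re ∂μ.prod μ := by
  have hc : Continuous fun p : Circle × Circle => f p.1 * (starRingEnd ℂ) (f p.2) := by fun_prop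
  have h1 := integral_prod_mul (μ := μ) (ν := μ) f (fun x => (starRingEnd ℂ) (f x))
  rw [integral_conj, Complex.mul_conj] at h1
  have h2 := integral_re (𝕜 := ℂ) (continuous_integrable_prod (μ := μ) hc)
  simp only [RCLike.re_to_complex] at h2
  rw [h2, h1, Complex.ofReal_re, Complex.normSq_eq_norm_sq]

lemma re_kernel_eq (z : ℂ) (x y : Circle) :
    ((1 - (x : ℂ) * z)⁻¹ * (starRingEnd ℂ) (1 - (y : ℂ) * z)⁻¹).re -
      (((x : ℂ) * (1 - (x : ℂ) * z)⁻¹) * (starRingEnd ℂ) ((y : ℂ) * (1 - (y : ℂ) * z)⁻¹)).re =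
    (1 - ‖z‖ ^ 2) * (1 - ((x : ℂ) * (starRingEnd ℂ) (y : ℂ)).re) *
      ((normSq (1 - (x : ℂ) * z))⁻¹ * (normSq (1 - (y : ℂ) * z))⁻¹) := by
  have hx : (x : ℂ).re * (x : ℂ).re + (x : ℂ).im * (x : ℂ).im = 1 := Circle.normSq_coe x
  have hy : (y : ℂ).re * (y : ℂ).re + (y : ℂ).im * (y : ℂ).im = 1 := Circle.normSq_coe y
  rw [← Complex.normSq_eq_norm_sq, Complex.inv_def, Complex.inv_def]
  generalize normSq (1 - (x : ℂ) * z) = a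
  generalize normSq (1 - (y : ℂ) * z) = b
  generalize (x : ℂ) = u at *
  generalize (y : ℂ) = v at *
  obtain ⟨u1, u2⟩ := u
  obtain ⟨v1, v2⟩ := v
  obtain ⟨z1, z2⟩ := z
  simp only [normSq_apply] at *
  simp
  linear_combination (((v1 * z1 - v2 * z2) - (v1 ^ 2 + v2 ^ 2) * (z1 ^ 2 + z2 ^ 2)) * hx +
    ((u1 * z1 - u2 * z2) - (z1 ^ 2 + z2 ^ 2)) * hy) * (a⁻¹ * b⁻¹)

lemma quarter_le_inv_normSq {z : ℂ} (hz : ‖z‖ < 1) (x : Circle) :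
    1 / 4 ≤ (normSq (1 - (x : ℂ) * z))⁻¹ := by
  have h := one_sub_circle_mul_ne_zero hz x
  have h2 : ‖1 - (x : ℂ) * z‖ ≤ 2 := by
    refine (norm_sub_le _ _).trans ?_
    rw [norm_mul, Circle.norm_coe, norm_one]; linarith
  rw [one_div, Complex.normSq_eq_norm_sq]
  have := norm_pos_iff.mpr h
  gcongr
  nlinarith

lemma norm_inv_one_sub_le {z : ℂ} {r : ℝ} (hzr : ‖z‖ ≤ r) (hr : r < 1) (x : Circle) :
    ‖(1 - (x : ℂ) * z)⁻¹‖ ≤ (1 - r)⁻¹ := by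
  rw [norm_inv]
  have h2 : 1 - r ≤ ‖1 - (x : ℂ) * z‖ := by
    have := norm_sub_norm_le 1 ((x : ℂ) * z)
    rw [norm_mul, Circle.norm_coe, norm_one] at this; linarith
  gcongr

lemma kernel_lower_bound (μ : Measure Circle) [IsProbabilityMeasure μ] {z : ℂ} (hz : ‖z‖ < 1) :
    (1 - ‖z‖ ^ 2) / 16 * (1 - ‖∫ x : Circle, (x : ℂ) ∂μ‖ ^ 2) ≤
    ‖∫ x : Circle, (1 - (x : ℂ) * z)⁻¹ ∂μ‖ ^ 2 -
      ‖∫ x : Circle, (x : ℂ) * (1 - (x : ℂ) * z)⁻¹ ∂μ‖ ^ 2 := by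
  have hg := continuous_inv_one_sub hz
  have hg1 : Continuous fun p : Circle × Circle =>
      (1 - (p.1 : ℂ) * z)⁻¹ := hg.comp continuous_fst
  have hg2 : Continuous fun p : Circle × Circle =>
      (1 - (p.2 : ℂ) * z)⁻¹ := hg.comp continuous_snd
  have hc1 : Continuous fun p : Circle × Circle =>
      ((1 - (p.1 : ℂ) * z)⁻¹ * (starRingEnd ℂ) (1 - (p.2 : ℂ) * z)⁻¹).re :=
    Complex.continuous_re.comp (hg1.mul (Complex.continuous_conj.comp hg2))
  have hc2 : Continuous fun p : Circle × Circle =>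
      (((p.1 : ℂ) * (1 - (p.1 : ℂ) * z)⁻¹) *
        (starRingEnd ℂ) ((p.2 : ℂ) * (1 - (p.2 : ℂ) * z)⁻¹)).re :=
    Complex.continuous_re.comp (((by fun_prop : Continuous fun p : Circle × Circle =>
      (p.1 : ℂ)).mul hg1).mul (Complex.continuous_conj.comp
        ((by fun_prop : Continuous fun p : Circle × Circle => (p.2 : ℂ)).mul hg2)))
  rw [norm_integral_sq_eq_integral_prod hg, norm_integral_sq_eq_integral_prod (by fun_prop),
    norm_integral_sq_eq_integral_prod (by fun_prop),
    ← integral_sub (continuous_integrable_prod hc1) (continuous_integrable_prod hc2)]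
  have h1 : (1 : ℝ) = ∫ _ : Circle × Circle, (1 : ℝ) ∂μ.prod μ := by simp
  nth_rewrite 2 [h1]
  rw [← integral_sub (integrable_const _) (continuous_integrable_prod (by fun_prop)),
    ← integral_const_mul]
  refine integral_mono (continuous_integrable_prod (by fun_prop))
    (continuous_integrable_prod (hc1.sub hc2)) fun p => ?_
  dsimp only
  rw [re_kernel_eq]
  have hre : ((p.1 : ℂ) * (starRingEnd ℂ) (p.2 : ℂ)).re ≤ 1 := by
    refine (Complex.re_le_norm _).trans ?_
    rw [norm_mul, Complex.norm_conj, Circle.norm_coe, Circle.norm_coe, one_mul]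
  have hzz : 0 ≤ 1 - ‖z‖ ^ 2 := by nlinarith [norm_nonneg z]
  have hab : (1 / 16 : ℝ) ≤ (normSq (1 - (p.1 : ℂ) * z))⁻¹ * (normSq (1 - (p.2 : ℂ) * z))⁻¹ := by
    have := mul_le_mul (quarter_le_inv_normSq hz p.1) (quarter_le_inv_normSq hz p.2)
      (by norm_num) (inv_nonneg.mpr (normSq_nonneg _))
    linarith
  have := mul_le_mul_of_nonneg_left hab (mul_nonneg hzz (sub_nonneg.mpr hre))
  linarith

lemma norm_BT_sq_le (μ : Measure Circle) [IsProbabilityMeasure μ] {z : ℂ} {r : ℝ} (hzr : ‖z‖ ≤ r)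
    (hr : r < 1) :
    ‖BT μ z‖ ^ 2 ≤
      1 - (1 - r ^ 2) * (1 - r) ^ 2 / 16 * (1 - ‖∫ x : Circle, (x : ℂ) ∂μ‖ ^ 2) := by
  have hz : ‖z‖ < 1 := hzr.trans_lt hr
  have hr0 : 0 ≤ r := (norm_nonneg z).trans hzr
  have hm : ‖∫ x : Circle, (x : ℂ) ∂μ‖ ≤ 1 := by
    simpa using norm_integral_le_of_norm_le_const (μ := μ) (f := fun x : Circle => (x : ℂ))
      (C := 1) (Eventually.of_forall fun x => (Circle.norm_coe x).le)
  have hG : ‖∫ x : Circle, (1 - (x : ℂ) * z)⁻¹ ∂μ‖ ≤ (1 - r)⁻¹ := by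
    simpa using norm_integral_le_of_norm_le_const (μ := μ)
      (Eventually.of_forall (norm_inv_one_sub_le hzr hr))
  have hk := kernel_lower_bound μ hz
  rw [BT_eq_div μ hz, norm_div]
  have hm0 := norm_nonneg (∫ x : Circle, (x : ℂ) ∂μ)
  have hG0 := norm_nonneg (∫ x : Circle, (1 - (x : ℂ) * z)⁻¹ ∂μ)
  generalize ‖∫ x : Circle, (x : ℂ) ∂μ‖ = m at *
  generalize ‖∫ x : Circle, (1 - (x : ℂ) * z)⁻¹ ∂μ‖ = G at *
  generalize ‖∫ x : Circle, (x : ℂ) * (1 - (x : ℂ) * z)⁻¹ ∂μ‖ = H at *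
  have hm1 : 0 ≤ 1 - m ^ 2 := by nlinarith
  have hr1 : 0 ≤ 1 - r ^ 2 := by nlinarith
  rcases hG0.eq_or_lt with h0 | h0
  · rw [← h0, div_zero]
    have h1 : (1 - r ^ 2) * (1 - r) ^ 2 ≤ 1 :=
      mul_le_one₀ (by nlinarith) (by positivity) (by nlinarith)
    nlinarith [mul_nonneg (mul_nonneg hr1 (sq_nonneg (1 - r))) hm1, sq_nonneg m]
  · have h1 : ((1 - r) * G) ^ 2 ≤ 1 := by
      have : (1 - r) * G ≤ 1 := by
        rw [← le_inv_mul_iff₀ (by linarith), mul_one]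
        exact hG
      have h2 : 0 ≤ (1 - r) * G := mul_nonneg (by linarith) hG0
      nlinarith
    have h2 : 1 - r ^ 2 ≤ 1 - ‖z‖ ^ 2 := by nlinarith [norm_nonneg z]
    have h3 : (1 - r ^ 2) * ((1 - r) * G) ^ 2 ≤ 1 - ‖z‖ ^ 2 := by nlinarith
    rw [div_pow, div_le_iff₀ (by positivity)]
    nlinarith [mul_le_mul_of_nonneg_right h3 hm1]

lemma abs_sin_sub_self_le (u : ℝ) : |Real.sin u - u| ≤ 2 * u ^ 2 := by
  have key : ∀ v : ℝ, 0 ≤ v → |Real.sin v - v| ≤ 2 * v ^ 2 := fun v hv => by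
    rw [abs_sub_comm, abs_of_nonneg (sub_nonneg.mpr (Real.sin_le hv))]
    rcases le_total v 1 with h1 | h1
    · rcases hv.eq_or_lt with h0 | h0
      · simp [← h0]
      · nlinarith [Real.sin_gt_sub_cube h0, sq_nonneg v]
    · nlinarith [Real.neg_one_le_sin v]
  rcases le_total 0 u with h | h
  · exact key u h
  · have := key (-u) (by linarith)
    rwa [Real.sin_neg, neg_sq, ← abs_neg, show -(-Real.sin u - -u) = Real.sin u - u by ring] at this

lemma two_div_pi_sq_mul_sq_le {u : ℝ} (hu : |u| ≤ Real.pi) :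
    2 / Real.pi ^ 2 * u ^ 2 ≤ 1 - Real.cos u := by
  linarith [Real.cos_le_one_sub_mul_cos_sq hu]

lemma exists_abs_sin_sub_truncation_le {τ : ℝ} (hτ : 0 < τ ∧ τ < Real.pi) :
    ∃ C : ℝ, 0 ≤ C ∧ ∀ β θ : ℝ, |β| ≤ 1 → |β| ≤ τ / 2 → |β| ≤ Real.pi - τ → |θ| ≤ Real.pi →
      |Real.sin (θ - β) - ((if |θ| < τ then θ else 0) - β)| ≤ C * (1 - Real.cos (θ - β)) := by
  have hpi := Real.pi_pos
  have hτ0 := hτ.1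
  refine ⟨Real.pi ^ 2 + 2 + 4 * Real.pi ^ 2 / τ ^ 2, by positivity, fun β θ h1 h2 h3 hθ => ?_⟩
  have hcos : 0 ≤ 1 - Real.cos (θ - β) := sub_nonneg.mpr (Real.cos_le_one _)
  have hτ2 : 0 ≤ 4 * Real.pi ^ 2 / τ ^ 2 := by positivity
  split_ifs with h
  · have hu : |θ - β| ≤ Real.pi := (abs_sub _ _).trans (by linarith)
    calc _ ≤ 2 * (θ - β) ^ 2 := abs_sin_sub_self_le _
      _ = Real.pi ^ 2 * (2 / Real.pi ^ 2 * (θ - β) ^ 2) := by field_simp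
      _ ≤ Real.pi ^ 2 * (1 - Real.cos (θ - β)) := by gcongr; exact two_div_pi_sq_mul_sq_le hu
      _ ≤ _ := by gcongr; linarith
  · have hl : |Real.sin (θ - β) - (0 - β)| ≤ 2 := by
      rw [show Real.sin (θ - β) - (0 - β) = Real.sin (θ - β) + β by ring]
      exact (abs_add_le _ _).trans (by linarith [Real.abs_sin_le_one (θ - β)])
    refine hl.trans ?_
    rcases le_or_gt |θ - β| Real.pi with hu | hu
    · have h4 : τ / 2 ≤ |θ - β| := by
        linarith [abs_sub_abs_le_abs_sub θ β, not_lt.mp h]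
      calc (2 : ℝ) = 4 * Real.pi ^ 2 / τ ^ 2 * (2 / Real.pi ^ 2 * (τ / 2) ^ 2) := by
            field_simp; norm_num
        _ ≤ 4 * Real.pi ^ 2 / τ ^ 2 * (2 / Real.pi ^ 2 * (θ - β) ^ 2) := by
          rw [← sq_abs (θ - β)]; gcongr
        _ ≤ 4 * Real.pi ^ 2 / τ ^ 2 * (1 - Real.cos (θ - β)) := by
          gcongr; exact two_div_pi_sq_mul_sq_le hu
        _ ≤ _ := by gcongr; nlinarith
    · have h4 : Real.cos (θ - β) ≤ 0 := by
        rw [← Real.cos_abs]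
        refine Real.cos_nonpos_of_pi_div_two_le_of_le (by linarith) ?_
        exact (abs_sub _ _).trans (by linarith)
      nlinarith

lemma abs_arg_le_mul_norm_sub_one (x : Circle) :
    |Complex.arg (x : ℂ)| ≤ Real.pi / 2 * ‖(x : ℂ) - 1‖ := by
  rw [← Complex.angle_one_right x.coe_ne_zero]
  exact Complex.angle_le_mul_norm_sub (Circle.norm_coe x) norm_one

lemma measurable_circle_arg : Measurable fun x : Circle => Complex.arg (x : ℂ) :=
  Complex.measurable_arg.comp (by fun_prop : Continuous _).measurable

lemma measurableSet_abs_arg_lt (τ : ℝ) :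
    MeasurableSet {x : Circle | |Complex.arg (x : ℂ)| < τ} :=
  measurableSet_lt measurable_circle_arg.abs measurable_const

lemma integrable_arg (μ : Measure Circle) [IsFiniteMeasure μ] :
    Integrable (fun x : Circle => Complex.arg (x : ℂ)) μ :=
  Integrable.of_bound measurable_circle_arg.aestronglyMeasurable Real.pi
    (Eventually.of_forall fun _ => Complex.abs_arg_le_pi _)

lemma abs_betaT_le (τ : ℝ) (μ : Measure Circle) [IsFiniteMeasure μ] :
    |betaT τ μ| ≤ Real.pi / 2 * ∫ x : Circle, ‖(x : ℂ) - 1‖ ∂μ := by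
  calc |betaT τ μ| ≤ ∫ x in {x : Circle | |Complex.arg (x : ℂ)| < τ}, |Complex.arg (x : ℂ)| ∂μ :=
        abs_integral_le_integral_abs
    _ ≤ ∫ x : Circle, |Complex.arg (x : ℂ)| ∂μ :=
        setIntegral_le_integral (integrable_arg μ).abs (Eventually.of_forall fun _ => abs_nonneg _)
    _ ≤ ∫ x : Circle, Real.pi / 2 * ‖(x : ℂ) - 1‖ ∂μ :=
        integral_mono (integrable_arg μ).abs (continuous_integrable (by fun_prop))
          abs_arg_le_mul_norm_sub_one
    _ = _ := integral_const_mul _ _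

instance (τ : ℝ) (μ : Measure Circle) [IsProbabilityMeasure μ] :
    IsProbabilityMeasure (centerT τ μ) :=
  Measure.isProbabilityMeasure_map (by fun_prop : Continuous _).aemeasurable

lemma integral_centerT {E : Type*} [NormedAddCommGroup E] [NormedSpace ℝ E] (τ : ℝ)
    (μ : Measure Circle) {f : Circle → E} (hf : Continuous f) :
    ∫ x, f x ∂(centerT τ μ) = ∫ x, f ((bT τ μ)⁻¹ * x) ∂μ :=
  integral_map (by fun_prop : Continuous _).aemeasurable
    hf.aestronglyMeasurable

lemma bT_inv_mul_eq_exp (τ : ℝ) (μ : Measure Circle) (x : Circle) :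
    (bT τ μ)⁻¹ * x = Circle.exp (Complex.arg (x : ℂ) - betaT τ μ) := by
  rw [Circle.exp_sub, Circle.exp_arg, bT, div_eq_inv_mul]

lemma circle_exp_re (t : ℝ) : ((Circle.exp t : Circle) : ℂ).re = Real.cos t := by
  rw [Circle.coe_exp, Complex.exp_ofReal_mul_I_re]

lemma circle_exp_im (t : ℝ) : ((Circle.exp t : Circle) : ℂ).im = Real.sin t := by
  rw [Circle.coe_exp, Complex.exp_ofReal_mul_I_im]

lemma norm_integral_sq_eq (τ : ℝ) (μ : Measure Circle) [IsProbabilityMeasure μ] :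
    ‖∫ x : Circle, (x : ℂ) ∂μ‖ ^ 2 =
      (1 - ∫ x : Circle, (1 - (x : ℂ).re) ∂(centerT τ μ)) ^ 2 +
        (∫ x : Circle, (x : ℂ).im ∂(centerT τ μ)) ^ 2 := by
  have h1 : ‖∫ x : Circle, (x : ℂ) ∂μ‖ = ‖∫ x : Circle, (x : ℂ) ∂(centerT τ μ)‖ := by
    rw [integral_centerT τ μ (by fun_prop)]
    simp only [Circle.coe_mul]
    rw [integral_const_mul, norm_mul, Circle.norm_coe, one_mul]
  have hi : Integrable (fun x : Circle => (x : ℂ)) (centerT τ μ) :=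
    continuous_integrable (by fun_prop)
  have hre := integral_re (𝕜 := ℂ) hi
  have him := integral_im (𝕜 := ℂ) hi
  simp only [RCLike.re_to_complex, RCLike.im_to_complex] at hre him
  rw [h1, integral_sub (integrable_const _) (continuous_integrable (by fun_prop)), hre, him,
    ← Complex.normSq_eq_norm_sq, Complex.normSq_apply]
  simp
  ring

lemma abs_integral_im_centerT_le {τ C : ℝ} {μ : Measure Circle} [IsProbabilityMeasure μ]
    (hC : ∀ θ : ℝ, |θ| ≤ Real.pi →
      |Real.sin (θ - betaT τ μ) - ((if |θ| < τ then θ else 0) - betaT τ μ)| ≤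
        C * (1 - Real.cos (θ - betaT τ μ))) :
    |∫ x : Circle, (x : ℂ).im ∂(centerT τ μ)| ≤
      C * ∫ x : Circle, (1 - (x : ℂ).re) ∂(centerT τ μ) := by
  rw [integral_centerT τ μ (by fun_prop), integral_centerT τ μ (by fun_prop)]
  have hi1 : Integrable (fun x : Circle => (((bT τ μ)⁻¹ * x : Circle) : ℂ).im) μ :=
    continuous_integrable (by fun_prop)
  have hi2 : Integrable (fun x : Circle => 1 - (((bT τ μ)⁻¹ * x : Circle) : ℂ).re) μ :=
    continuous_integrable (by fun_prop)
  simp only [bT_inv_mul_eq_exp, circle_exp_re, circle_exp_im] at hi1 hi2 ⊢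
  have hA : Integrable (fun x : Circle =>
      if |Complex.arg (x : ℂ)| < τ then Complex.arg (x : ℂ) else 0) μ :=
    (integrable_arg μ).indicator (measurableSet_abs_arg_lt τ)
  have hAβ : Integrable (fun x : Circle =>
      (if |Complex.arg (x : ℂ)| < τ then Complex.arg (x : ℂ) else 0) - betaT τ μ) μ :=
    hA.sub (integrable_const _)
  have hβ : ∫ x : Circle, ((if |Complex.arg (x : ℂ)| < τ then Complex.arg (x : ℂ) else 0) -
      betaT τ μ) ∂μ = 0 := by
    rw [integral_sub hA (integrable_const _)]
    have := integral_indicator (μ := μ) (f := fun x : Circle => Complex.arg (x : ℂ))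
      (measurableSet_abs_arg_lt τ)
    simp only [Set.indicator, Set.mem_ofPred_eq] at this
    rw [this]
    simp [betaT]
  have h0 : ∫ x : Circle, Real.sin (Complex.arg (x : ℂ) - betaT τ μ) ∂μ =
      ∫ x : Circle, (Real.sin (Complex.arg (x : ℂ) - betaT τ μ) -
        ((if |Complex.arg (x : ℂ)| < τ then Complex.arg (x : ℂ) else 0) - betaT τ μ)) ∂μ := by
    rw [integral_sub hi1 hAβ, hβ, sub_zero]
  rw [h0, ← integral_const_mul]
  refine abs_integral_le_integral_abs.trans (integral_mono
    (hi1.sub hAβ).abs (hi2.const_mul C) fun x => ?_)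
  exact hC _ (Complex.abs_arg_le_pi _)

lemma integral_one_sub_re_centerT_nonneg (τ : ℝ) (μ : Measure Circle) :
    0 ≤ ∫ x : Circle, (1 - (x : ℂ).re) ∂(centerT τ μ) :=
  integral_nonneg fun x => sub_nonneg.mpr ((Complex.re_le_norm _).trans (Circle.norm_coe x).le)

lemma integral_one_sub_re_centerT_le (τ : ℝ) (μ : Measure Circle) [IsProbabilityMeasure μ] :
    ∫ x : Circle, (1 - (x : ℂ).re) ∂(centerT τ μ) ≤
      (1 + Real.pi / 2) * ∫ x : Circle, ‖(x : ℂ) - 1‖ ∂μ := by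
  rw [integral_centerT τ μ (by fun_prop)]
  have hb : ‖(bT τ μ : ℂ) - 1‖ ≤ |betaT τ μ| := by
    rw [bT, Circle.coe_exp, mul_comm]
    exact Real.norm_exp_I_mul_ofReal_sub_one_le
  have hpt : ∀ x : Circle, 1 - (((bT τ μ)⁻¹ * x : Circle) : ℂ).re ≤
      ‖(x : ℂ) - 1‖ + |betaT τ μ| := fun x => by
    have h1 : 1 - (((bT τ μ)⁻¹ * x : Circle) : ℂ).re ≤ ‖(bT τ μ : ℂ) - x‖ := by
      have h2 : ‖1 - (((bT τ μ)⁻¹ * x : Circle) : ℂ)‖ = ‖(bT τ μ : ℂ) - x‖ := by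
        rw [← one_mul ‖1 - _‖, ← Circle.norm_coe (bT τ μ), ← norm_mul, mul_sub, ← Circle.coe_mul,
          mul_inv_cancel_left, mul_one]
      rw [← h2]
      exact Complex.re_le_norm (1 - (((bT τ μ)⁻¹ * x : Circle) : ℂ))
    have h3 : ‖(bT τ μ : ℂ) - x‖ ≤ ‖(bT τ μ : ℂ) - 1‖ + ‖(x : ℂ) - 1‖ := by
      rw [norm_sub_rev (x : ℂ) 1]
      exact norm_sub_le_norm_sub_add_norm_sub _ _ _
    linarith
  calc _ ≤ ∫ x : Circle, (‖(x : ℂ) - 1‖ + |betaT τ μ|) ∂μ :=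
        integral_mono (continuous_integrable (by fun_prop)) (continuous_integrable (by fun_prop)) hpt
    _ = (∫ x : Circle, ‖(x : ℂ) - 1‖ ∂μ) + |betaT τ μ| := by
        rw [integral_add (continuous_integrable (by fun_prop)) (integrable_const _)]; simp
    _ ≤ _ := by linarith [abs_betaT_le τ μ]

lemma integral_norm_sub_one_le (μ : Measure Circle) [IsProbabilityMeasure μ] {ε : ℝ} (hε : 0 ≤ ε) :
    ∫ x : Circle, ‖(x : ℂ) - 1‖ ∂μ ≤ ε + 2 * μ.real {x : Circle | ε ≤ ‖(x : ℂ) - 1‖} := by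
  have hS : MeasurableSet {x : Circle | ε ≤ ‖(x : ℂ) - 1‖} :=
    (isClosed_le (by fun_prop) (by fun_prop)).measurableSet
  have hi : Integrable ({x : Circle | ε ≤ ‖(x : ℂ) - 1‖}.indicator fun _ => (2 : ℝ)) μ :=
    (integrable_const _).indicator hS
  calc _ ≤ ∫ x : Circle,
        (ε + {x : Circle | ε ≤ ‖(x : ℂ) - 1‖}.indicator (fun _ => (2 : ℝ)) x) ∂μ := by
        refine integral_mono (continuous_integrable (by fun_prop))
          ((integrable_const _).add hi) fun x => ?_
        simp only [Set.indicator, Set.mem_ofPred_eq]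
        split_ifs with h
        · have := norm_sub_le (x : ℂ) 1
          rw [Circle.norm_coe, norm_one] at this
          linarith
        · linarith
    _ = _ := by
        rw [integral_add (integrable_const _) hi, integral_indicator hS]
        simp [mul_comm]

lemma IsInfinitesimalArrayT.eventually_integral_le {kn : ℕ → ℕ} {μ : ℕ → ℕ → Measure Circle}
    (hprob : ∀ n i, IsProbabilityMeasure (μ n i)) (hinf : IsInfinitesimalArrayT kn μ) {η : ℝ}
    (hη : 0 < η) :
    ∀ᶠ n in atTop, ∀ i < kn n, ∫ x : Circle, ‖(x : ℂ) - 1‖ ∂(μ n i) ≤ η := by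
  obtain ⟨N, hN⟩ := hinf (η / 2) (by positivity) (ENNReal.ofReal (η / 4))
    (ENNReal.ofReal_pos.mpr (by positivity))
  filter_upwards [eventually_ge_atTop N] with n hn i hi
  have h1 := integral_norm_sub_one_le (μ n i) (ε := η / 2) (by positivity)
  have h2 : (μ n i).real {x : Circle | η / 2 ≤ ‖(x : ℂ) - 1‖} ≤ η / 4 :=
    ENNReal.toReal_le_of_le_ofReal (by positivity) (hN n hn i hi).le
  linarith

lemma exists_norm_integral_sq_le {τ : ℝ} (hτ : 0 < τ ∧ τ < Real.pi) :
    ∃ η : ℝ, 0 < η ∧ ∀ μ : Measure Circle, IsProbabilityMeasure μ →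
      ∫ x : Circle, ‖(x : ℂ) - 1‖ ∂μ ≤ η →
      ‖∫ x : Circle, (x : ℂ) ∂μ‖ ^ 2 ≤ 1 - ∫ x : Circle, (1 - (x : ℂ).re) ∂(centerT τ μ) := by
  obtain ⟨C, hC0, hC⟩ := exists_abs_sin_sub_truncation_le hτ
  have hpi := Real.pi_pos
  have hδ : 0 < min 1 (min (τ / 2) (Real.pi - τ)) :=
    lt_min one_pos (lt_min (by linarith [hτ.1]) (by linarith [hτ.2]))
  refine ⟨min (min 1 (min (τ / 2) (Real.pi - τ)) / (Real.pi / 2))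
    (1 / (1 + C ^ 2) / (1 + Real.pi / 2)), by positivity, fun μ _ hD => ?_⟩
  have hD1 := (le_div_iff₀' (by positivity)).mp (hD.trans (min_le_left _ _))
  have hD2 := (le_div_iff₀' (by positivity)).mp (hD.trans (min_le_right _ _))
  have hβ := (abs_betaT_le τ μ).trans hD1
  rw [le_min_iff, le_min_iff] at hβ
  have hs := (integral_one_sub_re_centerT_le τ μ).trans hD2
  have hs0 := integral_one_sub_re_centerT_nonneg τ μ
  have hy := abs_integral_im_centerT_le (τ := τ) (C := C) (μ := μ)
    fun θ => hC _ θ hβ.1 hβ.2.1 hβ.2.2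
  rw [norm_integral_sq_eq τ μ]
  generalize ∫ x : Circle, (1 - (x : ℂ).re) ∂(centerT τ μ) = s at *
  generalize ∫ x : Circle, (x : ℂ).im ∂(centerT τ μ) = y at *
  have hy2 : y ^ 2 ≤ (C * s) ^ 2 := sq_le_sq' (abs_le.mp hy).1 (abs_le.mp hy).2
  rw [le_div_iff₀ (by positivity)] at hs
  nlinarith [mul_le_mul_of_nonneg_left hs hs0]

lemma one_sub_integral_le_norm_integral (τ : ℝ) (μ : Measure Circle) [IsProbabilityMeasure μ] :
    1 - ∫ x : Circle, (1 - (x : ℂ).re) ∂(centerT τ μ) ≤ ‖∫ x : Circle, (x : ℂ) ∂μ‖ :=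
  le_of_sq_le_sq (by
    rw [norm_integral_sq_eq τ μ]
    linarith [sq_nonneg (∫ x : Circle, (x : ℂ).im ∂(centerT τ μ))]) (norm_nonneg _)

lemma exp_neg_two_mul_le_one_sub {s : ℝ} (h0 : 0 ≤ s) (h1 : s ≤ 1 / 2) :
    Real.exp (-(2 * s)) ≤ 1 - s := by
  rw [Real.exp_neg, inv_le_comm₀ (Real.exp_pos _) (by linarith)]
  refine le_trans ?_ (Real.add_one_le_exp (2 * s))
  rw [inv_le_iff_one_le_mul₀ (by linarith)]
  nlinarith

lemma exists_norm_le_lt_one_of_isCompact {K : Set ℂ} (hK : K ⊆ ball (0 : ℂ) 1)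
    (hc : IsCompact K) : ∃ r : ℝ, 0 ≤ r ∧ r < 1 ∧ ∀ z ∈ K, ‖z‖ ≤ r := by
  rcases K.eq_empty_or_nonempty with rfl | hne
  · exact ⟨0, le_rfl, one_pos, by simp⟩
  · obtain ⟨w, hw, hmax⟩ := hc.exists_isMaxOn hne continuous_norm.continuousOn
    exact ⟨‖w‖, norm_nonneg w, by simpa using hK hw, fun z hz => hmax hz⟩

lemma tendsto_sum_of_tendstoUniformlyOn {τ : ℝ} {kn : ℕ → ℕ} {μ : ℕ → ℕ → Measure Circle}
    (hprob : ∀ n i, IsProbabilityMeasure (μ n i)) (hinf : IsInfinitesimalArrayT kn μ)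
    {lam : ℕ → Circle}
    (h : Tendsto (fun n => (lam n : ℂ) * ∏ i ∈ Finset.range (kn n), BT (μ n i) 0) atTop (𝓝 0)) :
    Tendsto (fun n => ∑ i ∈ Finset.range (kn n),
      ∫ ζ : Circle, (1 - (ζ : ℂ).re) ∂(centerT τ (μ n i))) atTop atTop := by
  have hpi := Real.pi_pos
  rw [tendsto_zero_iff_norm_tendsto_zero] at h
  refine tendsto_atTop.mpr fun M => ?_
  filter_upwards [h.eventually_lt_const (Real.exp_pos (-(2 * M))),
    hinf.eventually_integral_le hprob (η := 1 / 2 / (1 + Real.pi / 2)) (by positivity)] with n hn hD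
  have hle : Real.exp (-(2 * ∑ i ∈ Finset.range (kn n),
      ∫ ζ : Circle, (1 - (ζ : ℂ).re) ∂(centerT τ (μ n i)))) ≤
      ‖(lam n : ℂ) * ∏ i ∈ Finset.range (kn n), BT (μ n i) 0‖ := by
    rw [norm_mul, Circle.norm_coe, one_mul, norm_prod, Finset.mul_sum, ← Finset.sum_neg_distrib,
      Real.exp_sum]
    refine Finset.prod_le_prod (fun _ _ => (Real.exp_pos _).le) fun i hi => ?_
    have hs := (integral_one_sub_re_centerT_le τ (μ n i)).trans
      ((le_div_iff₀' (by positivity)).mp (hD i (Finset.mem_range.mp hi)))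
    rw [BT, if_pos rfl]
    exact (exp_neg_two_mul_le_one_sub (integral_one_sub_re_centerT_nonneg _ _) hs).trans
      (one_sub_integral_le_norm_integral τ _)
  have := Real.exp_lt_exp.mp (hle.trans_lt hn)
  linarith

lemma norm_BT_le_exp {μ : Measure Circle} [IsProbabilityMeasure μ] {z : ℂ} {r s : ℝ}
    (hzr : ‖z‖ ≤ r) (hr : r < 1) (hs : ‖∫ x : Circle, (x : ℂ) ∂μ‖ ^ 2 ≤ 1 - s) :
    ‖BT μ z‖ ≤ Real.exp (-((1 - r ^ 2) * (1 - r) ^ 2 / 32 * s)) := by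
  have hr0 : 0 ≤ r := (norm_nonneg z).trans hzr
  have hc : 0 ≤ (1 - r ^ 2) * (1 - r) ^ 2 / 16 := by
    have : 0 ≤ 1 - r ^ 2 := by nlinarith
    positivity
  refine le_of_sq_le_sq ?_ (Real.exp_pos _).le
  rw [← Real.exp_nat_mul]
  refine (norm_BT_sq_le μ hzr hr).trans (le_trans ?_ (Real.add_one_le_exp _))
  push_cast
  nlinarith [mul_le_mul_of_nonneg_left hs hc]

lemma tendstoUniformlyOn_of_tendsto_sum {τ : ℝ} (hτ : 0 < τ ∧ τ < Real.pi) {kn : ℕ → ℕ}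
    {μ : ℕ → ℕ → Measure Circle}
    (hprob : ∀ n i, IsProbabilityMeasure (μ n i)) (hinf : IsInfinitesimalArrayT kn μ)
    (lam : ℕ → Circle)
    (h : Tendsto (fun n => ∑ i ∈ Finset.range (kn n),
      ∫ ζ : Circle, (1 - (ζ : ℂ).re) ∂(centerT τ (μ n i))) atTop atTop)
    {K : Set ℂ} (hK : K ⊆ ball (0 : ℂ) 1) (hKc : IsCompact K) :
    TendstoUniformlyOn (fun n z => (lam n : ℂ) * ∏ i ∈ Finset.range (kn n), BT (μ n i) z)
      (fun _ => (0 : ℂ)) atTop K := by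
  obtain ⟨r, hr0, hr, hKr⟩ := exists_norm_le_lt_one_of_isCompact hK hKc
  obtain ⟨η, hη, hsq⟩ := exists_norm_integral_sq_le hτ
  have hc : 0 < (1 - r ^ 2) * (1 - r) ^ 2 / 32 := by
    have h1 : 0 < 1 - r ^ 2 := by nlinarith
    have h2 : 0 < 1 - r := by linarith
    positivity
  have hexp := Real.tendsto_exp_neg_atTop_nhds_zero.comp (h.const_mul_atTop hc)
  rw [Metric.tendstoUniformlyOn_iff]
  intro ε hε
  filter_upwards [hexp.eventually_lt_const hε, hinf.eventually_integral_le hprob hη]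
    with n hn hD z hz
  rw [dist_zero_left, norm_mul, Circle.norm_coe, one_mul, norm_prod]
  refine lt_of_le_of_lt ?_ hn
  rw [Function.comp_apply, Finset.mul_sum, ← Finset.sum_neg_distrib, Real.exp_sum]
  exact Finset.prod_le_prod (fun _ _ => norm_nonneg _) fun i hi =>
    norm_BT_le_exp (hKr z hz) hr (hsq _ (hprob n i) (hD i (Finset.mem_range.mp hi)))

/-- Theorem 3.6, (1) ⇔ (3): the boolean convolutions δ_{λ_n} ⨃ μ_{n1} ⨃ ⋯ ⨃ μ_{nk_n}
converge weakly to Haar measure (B-transforms → 0 uniformly on compacts of 𝔻) iff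
Σ_{k=1}^{k_n} ∫ (1−Re ζ) dμ_{nk}° → +∞. -/
theorem stmt7
    (τ : ℝ) (hτ : 0 < τ ∧ τ < Real.pi)
    (kn : ℕ → ℕ) (μ : ℕ → ℕ → Measure Circle)
    (hprob : ∀ n i, IsProbabilityMeasure (μ n i))
    (hinf : IsInfinitesimalArrayT kn μ)
    (hmom : ∀ n : ℕ, ∀ i < kn n, (∫ ζ : Circle, (ζ : ℂ) ∂(μ n i)) ≠ 0)
    (lam : ℕ → Circle) :
    (∀ K : Set ℂ, K ⊆ ball (0:ℂ) 1 → IsCompact K →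
      TendstoUniformlyOn
        (fun n z => ((lam n : ℂ)) * ∏ i ∈ Finset.range (kn n), BT (μ n i) z)
        (fun _ => (0 : ℂ)) atTop K) ↔
    Tendsto (fun n => ∑ i ∈ Finset.range (kn n),
        ∫ ζ : Circle, (1 - ((ζ : ℂ)).re) ∂(centerT τ (μ n i))) atTop atTop := by
  refine ⟨fun h => tendsto_sum_of_tendstoUniformlyOn hprob hinf
    ((h {0} (by simp) isCompact_singleton).tendsto_at (Set.mem_singleton 0)),
    fun h K hK hKc => tendstoUniformlyOn_of_tendsto_sum hτ hprob hinf lam h hK hKc⟩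

end
end

section
/- Let {μ_{nk}} be an infinitesimal array of probability measures on 𝕋, each with nonzero first moment, let {λ_n}_{n≥1} ⊂ 𝕋, let γ ∈ 𝕋 and let σ be a finite positive Borel measure on 𝕋. Assume λ_n · Π_{k=1}^{k_n} B_{μ_{nk}}(z) converges to γ·exp(−∫_𝕋 (1+ζz)/(1−ζz) dσ(ζ)) uniformly on compact subsets of 𝔻 (i.e., the boolean convolutions δ_{λ_n} ⨃ μ_{n1} ⨃ ⋯ ⨃ μ_{nk_n} converge weakly to ν_⨃^{γ,σ}). Then there exists a Borel probability measure ν on 𝕋 with ∫_𝕋 ζ^p dν(ζ) = γ^p·exp(∫_𝕋 K_p(ζ) dσ(ζ)) for every p ∈ ℤ, and for every p ∈ ℤ one has lim_{n→∞} λ_n^p · Π_{k=1}^{k_n} ∫_𝕋 ζ^p dμ_{nk}(ζ) = γ^p·exp(∫_𝕋 K_p(ζ) dσ(ζ)); consequently the classical convolutions δ_{λ_n} ⊛ μ_{n1} ⊛ ⋯ ⊛ μ_{nk_n} converge weakly to ν. -/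
open MeasureTheory Complex Filter Topology Metric

noncomputable section

/-- K_p(ζ) = (ζ^p − 1 − i·p·Im ζ)/(1 − Re ζ), with K_p(1) = −p². -/
def Kp (p : ℤ) (ζ : Circle) : ℂ :=
  if (ζ : ℂ) = 1 then -((p : ℂ))^2
  else ((ζ : ℂ) ^ p - 1 - Complex.I * (p : ℂ) * ((((ζ : ℂ)).im : ℝ) : ℂ))
      / (((1 - ((ζ : ℂ)).re : ℝ)) : ℂ)

/-- The B-transform of the ⨃-infinitely divisible measure ν_⨃^{γ,σ}. -/
def BID (γ : Circle) (σ : Measure Circle) (z : ℂ) : ℂ :=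
  (γ : ℂ) * Complex.exp (-∫ ζ : Circle, (1 + (ζ : ℂ) * z) / (1 - (ζ : ℂ) * z) ∂σ)

lemma Circle.integrable_of_continuous (μ : Measure Circle) [IsFiniteMeasure μ]
    {E : Type*} [NormedAddCommGroup E] {f : Circle → E} (hf : Continuous f) :
    Integrable f μ := by
  rw [← integrableOn_univ]
  exact hf.continuousOn.integrableOn_compact isCompact_univ

lemma Circle.continuous_coe_zpow (p : ℤ) : Continuous fun ζ : Circle => (ζ : ℂ) ^ p := by
  have h : Continuous fun ζ : Circle => (ζ : ℂ) := by fun_prop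
  exact h.zpow₀ p fun ζ => Or.inl ζ.coe_ne_zero

/-- Finite multiplicative convolutions on the circle multiply Fourier coefficients. -/
lemma exists_convolution_fourier (m : ℕ → Measure Circle) (hm : ∀ i, IsProbabilityMeasure (m i))
    (c : Circle) (N : ℕ) :
    ∃ ρ : ProbabilityMeasure Circle, ∀ p : ℤ, ∫ ζ : Circle, (ζ : ℂ) ^ p ∂(ρ : Measure Circle)
      = (c : ℂ) ^ p * ∏ i ∈ Finset.range N, ∫ ζ : Circle, (ζ : ℂ) ^ p ∂(m i) := by
  induction N with
  | zero => exact ⟨⟨Measure.dirac c, inferInstance⟩, fun p => by simp⟩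
  | succ N ih =>
    obtain ⟨ρ, hρ⟩ := ih
    have hmul : Measurable fun x : Circle × Circle => x.1 * x.2 := by fun_prop
    refine ⟨⟨Measure.map (fun x : Circle × Circle => x.1 * x.2) ((ρ : Measure Circle).prod (m N)),
      Measure.isProbabilityMeasure_map hmul.aemeasurable⟩, fun p => ?_⟩
    rw [Finset.prod_range_succ, ← mul_assoc, ← hρ p]
    simp only [ProbabilityMeasure.coe_mk]
    rw [integral_map hmul.aemeasurable
      (Circle.continuous_coe_zpow p).aestronglyMeasurable]
    simp only [Circle.coe_mul, mul_zpow]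
    exact integral_prod_mul (fun ζ : Circle => (ζ : ℂ) ^ p) (fun ζ : Circle => (ζ : ℂ) ^ p)

/-- A sequence of probability measures whose Fourier coefficients converge has a limiting law. -/
lemma exists_probability_of_tendsto_fourier (ρ : ℕ → ProbabilityMeasure Circle) (φ : ℤ → ℂ)
    (h : ∀ p : ℤ, Tendsto (fun n => ∫ ζ : Circle, (ζ : ℂ) ^ p ∂(ρ n : Measure Circle)) atTop
      (𝓝 (φ p))) :
    ∃ ν : Measure Circle, IsProbabilityMeasure ν ∧ ∀ p : ℤ, ∫ ζ : Circle, (ζ : ℂ) ^ p ∂ν = φ p := by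
  have hle : (hyperfilter ℕ : Filter ℕ) ≤ atTop := Nat.hyperfilter_le_atTop
  obtain ⟨ν, -, hν⟩ := (isCompact_univ (X := ProbabilityMeasure Circle)).ultrafilter_le_nhds
    ((hyperfilter ℕ).map ρ) (by simp)
  refine ⟨ν, inferInstance, fun p => ?_⟩
  have ht : Tendsto ρ (hyperfilter ℕ : Filter ℕ) (𝓝 ν) := hν
  have := (ProbabilityMeasure.tendsto_iff_forall_integral_rclike_tendsto ℂ).1 ht
    (BoundedContinuousFunction.mkOfCompact ⟨_, Circle.continuous_coe_zpow p⟩)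
  exact tendsto_nhds_unique this ((h p).mono_left hle)

/-- Products of an infinitesimal array are asymptotic to exponentials of its row sums. -/
lemma tendsto_prod_mul_exp_neg_sum (kn : ℕ → ℕ) (s : ℕ → ℕ → ℝ) (f v : ℕ → ℕ → ℂ) (M C : ℝ)
    (hs0 : ∀ n i, 0 ≤ s n i)
    (hs : ∀ ε > 0, ∀ᶠ n in atTop, ∀ i < kn n, s n i ≤ ε)
    (hM : ∀ᶠ n in atTop, ∑ i ∈ Finset.range (kn n), s n i ≤ M)
    (hC : ∀ n i, ‖v n i‖ ≤ C * s n i)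
    (hf : ∀ ε > 0, ∀ᶠ n in atTop, ∀ i < kn n, ‖f n i - 1 - v n i‖ ≤ ε * s n i) :
    Tendsto (fun n => (∏ i ∈ Finset.range (kn n), f n i) *
      exp (-∑ i ∈ Finset.range (kn n), v n i)) atTop (𝓝 1) := by
  set D : ℝ := |C| + 1 with hD
  have hD0 : 0 < D := by positivity
  have hu : ∀ᶠ n in atTop, ∀ i < kn n, ‖f n i - 1‖ ≤ D * s n i := by
    filter_upwards [hf 1 one_pos] with n h1 i hi
    have e1 : ‖f n i - 1‖ ≤ ‖f n i - 1 - v n i‖ + ‖v n i‖ := by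
      simpa using norm_add_le (f n i - 1 - v n i) (v n i)
    have e2 : C * s n i ≤ |C| * s n i := mul_le_mul_of_nonneg_right (le_abs_self C) (hs0 n i)
    rw [hD]
    linarith [h1 i hi, hC n i]
  have hlog : ∀ ε > 0, ∀ᶠ n in atTop, ∀ i < kn n,
      f n i ≠ 0 ∧ ‖log (f n i) - v n i‖ ≤ ε * s n i := by
    intro ε hε
    filter_upwards [hu, hf (ε / 2) (by positivity), hs (1 / (2 * D)) (by positivity),
      hs (ε / (2 * D ^ 2)) (by positivity)] with n h1 h2 h3 h4 i hi
    have a1 := h1 i hi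
    have a2 := h2 i hi
    have a3 : D * s n i ≤ 1 / 2 := by
      calc D * s n i ≤ D * (1 / (2 * D)) := by gcongr; exact h3 i hi
        _ = 1 / 2 := by field_simp
    have a4 : D ^ 2 * s n i ≤ ε / 2 := by
      calc D ^ 2 * s n i ≤ D ^ 2 * (ε / (2 * D ^ 2)) := by gcongr; exact h4 i hi
        _ = ε / 2 := by field_simp
    set u := f n i - 1 with hu'
    have hfu : f n i = 1 + u := by rw [hu']; ring
    have hu1 : ‖u‖ ≤ 1 / 2 := a1.trans a3
    refine ⟨fun h0 => ?_, ?_⟩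
    · rw [h0] at hu'
      rw [hu'] at hu1
      norm_num at hu1
    have b1 := norm_log_one_add_sub_self_le (z := u) (by linarith)
    have b2 : ‖u‖ ^ 2 * (1 - ‖u‖)⁻¹ / 2 ≤ ‖u‖ ^ 2 := by
      have : (1 - ‖u‖)⁻¹ ≤ 2 := by
        rw [inv_le_comm₀ (by linarith) (by norm_num)]; linarith
      nlinarith [sq_nonneg ‖u‖]
    have b3 : ‖u‖ ^ 2 ≤ D ^ 2 * s n i * s n i := by
      calc ‖u‖ ^ 2 ≤ (D * s n i) ^ 2 := by gcongr
        _ = _ := by ring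
    have b4 : D ^ 2 * s n i * s n i ≤ ε / 2 * s n i := mul_le_mul_of_nonneg_right a4 (hs0 n i)
    rw [hfu]
    have b5 : ‖log (1 + u) - v n i‖ ≤ ‖log (1 + u) - u‖ + ‖u - v n i‖ := by
      simpa using norm_add_le (log (1 + u) - u) (u - v n i)
    linarith
  have hsum : Tendsto (fun n => ∑ i ∈ Finset.range (kn n), (log (f n i) - v n i)) atTop (𝓝 0) := by
    rw [Metric.tendsto_nhds]
    intro ε hε
    have hM' : 0 < |M| + 1 := by positivity
    filter_upwards [hlog (ε / (2 * (|M| + 1))) (by positivity), hM] with n h1 h2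
    rw [dist_zero_right]
    calc _ ≤ ∑ i ∈ Finset.range (kn n), ε / (2 * (|M| + 1)) * s n i :=
          norm_sum_le_of_le _ fun i hi => (h1 i (Finset.mem_range.1 hi)).2
      _ = ε / (2 * (|M| + 1)) * ∑ i ∈ Finset.range (kn n), s n i := by rw [Finset.mul_sum]
      _ ≤ ε / (2 * (|M| + 1)) * (|M| + 1) := by
          gcongr; linarith [le_abs_self M]
      _ = ε / 2 := by field_simp
      _ < ε := by linarith
  have := (continuous_exp.tendsto 0).comp hsum
  rw [exp_zero] at this
  refine this.congr' ?_
  filter_upwards [hlog 1 one_pos] with n h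
  rw [Function.comp_apply, Finset.sum_sub_distrib, sub_eq_add_neg, exp_add, exp_sum]
  congr 1
  refine Finset.prod_congr rfl fun i hi => ?_
  exact exp_log (h i (Finset.mem_range.1 hi)).1

/-- Pointwise convergence of power series with uniformly bounded coefficients
forces convergence of the coefficients. -/
lemma tendsto_coeff_of_tendsto_hasSum (a : ℕ → ℕ → ℂ) (g : ℕ → ℝ → ℂ) (M r : ℝ) (hr : 0 < r)
    (hr1 : r ≤ 1 / 2) (hM : ∀ᶠ n in atTop, ∀ k, ‖a n k‖ ≤ M)
    (hg : ∀ n, ∀ x : ℝ, 0 < x → x < r → HasSum (fun k => a n k * (x : ℂ) ^ k) (g n x))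
    (h : ∀ x : ℝ, 0 < x → x < r → Tendsto (fun n => g n x) atTop (𝓝 0)) (k : ℕ) :
    Tendsto (fun n => a n k) atTop (𝓝 0) := by
  induction k using Nat.strong_induction_on with
  | _ k ih =>
  rw [Metric.tendsto_nhds]
  intro ε hε
  have hM0 : 0 < |M| + 1 := by positivity
  obtain ⟨x, hx0, hx1⟩ : ∃ x : ℝ, 0 < x ∧ x < min r (ε / (4 * (|M| + 1))) :=
    exists_between (lt_min hr (by positivity))
  have hxr : x < r := hx1.trans_le (min_le_left _ _)
  have hxM : x * (|M| + 1) < ε / 4 := by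
    have := hx1.trans_le (min_le_right _ _)
    rw [lt_div_iff₀ (by positivity)] at this
    linarith
  have hlow : Tendsto (fun n => g n x - ∑ j ∈ Finset.range k, a n j * (x : ℂ) ^ j) atTop (𝓝 0) := by
    have : Tendsto (fun n => ∑ j ∈ Finset.range k, a n j * (x : ℂ) ^ j) atTop
        (𝓝 (∑ j ∈ Finset.range k, 0 * (x : ℂ) ^ j)) :=
      tendsto_finsetSum _ fun j hj => (ih j (Finset.mem_range.1 hj)).mul_const _
    simpa using (h x hx0 hxr).sub this
  rw [Metric.tendsto_nhds] at hlow
  filter_upwards [hM, hlow (ε / 2 * x ^ k) (by positivity)] with n h1 h2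
  rw [dist_zero_right] at h2 ⊢
  have hs := (hasSum_nat_add_iff' k).2 (hg n x hx0 hxr)
  have hs' := (hasSum_nat_add_iff' 1).2 hs
  simp only [Finset.range_one, Finset.sum_singleton, zero_add] at hs'
  have hgeo : HasSum (fun j : ℕ => (|M| + 1) * x ^ (k + 1) * x ^ j)
      ((|M| + 1) * x ^ (k + 1) * (1 - x)⁻¹) :=
    (hasSum_geometric_of_lt_one hx0.le (by linarith)).mul_left _
  have htail := tsum_of_norm_bounded hgeo (f := fun j => a n (j + 1 + k) * (x : ℂ) ^ (j + 1 + k))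
    fun j => by
      rw [norm_mul, norm_pow, norm_real, Real.norm_of_nonneg hx0.le]
      calc ‖a n (j + 1 + k)‖ * x ^ (j + 1 + k) ≤ (|M| + 1) * x ^ (j + 1 + k) := by
            gcongr; linarith [h1 (j + 1 + k), le_abs_self M]
        _ = _ := by ring
  rw [hs'.tsum_eq] at htail
  have hinv : (1 - x)⁻¹ ≤ 2 := by
    rw [inv_le_comm₀ (by linarith) (by norm_num)]; linarith
  have hmain : ‖a n k‖ * x ^ k < ε * x ^ k := by
    have e1 : ‖a n k‖ * x ^ k = ‖a n k * (x : ℂ) ^ k‖ := by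
      rw [norm_mul, norm_pow, norm_real, Real.norm_of_nonneg hx0.le]
    set L := g n x - ∑ j ∈ Finset.range k, a n j * (x : ℂ) ^ j
    have e2 : ‖a n k * (x : ℂ) ^ k‖ ≤ ‖L‖ + ‖L - a n k * (x : ℂ) ^ k‖ := by
      simpa using norm_sub_le L (L - a n k * (x : ℂ) ^ k)
    have e3 : (|M| + 1) * x ^ (k + 1) * (1 - x)⁻¹ ≤ ε / 2 * x ^ k := by
      calc _ ≤ (|M| + 1) * x ^ (k + 1) * 2 := by gcongr
        _ = (x * (|M| + 1)) * 2 * x ^ k := by ring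
        _ ≤ (ε / 4) * 2 * x ^ k := by gcongr
        _ = _ := by ring
    linarith
  exact lt_of_mul_lt_mul_right hmain (by positivity)

lemma Circle.coe_re_eq (ζ : Circle) : ((ζ : ℂ).re : ℂ) = ((ζ : ℂ) + (ζ : ℂ)⁻¹) / 2 := by
  rw [re_eq_add_conj, ← Circle.coe_inv_eq_conj, Circle.coe_inv]

lemma Circle.I_mul_im_eq (ζ : Circle) : I * ((ζ : ℂ).im : ℂ) = ((ζ : ℂ) - (ζ : ℂ)⁻¹) / 2 := by
  rw [im_eq_sub_conj, ← Circle.coe_inv_eq_conj, Circle.coe_inv]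
  field_simp

lemma Circle.one_sub_re_nonneg (ζ : Circle) : 0 ≤ 1 - (ζ : ℂ).re := by
  have := (re_le_norm (ζ : ℂ)).trans_eq ζ.norm_coe
  linarith

lemma Circle.one_sub_re_ne_zero {ζ : Circle} (h : (ζ : ℂ) ≠ 1) :
    ((1 - (ζ : ℂ).re : ℝ) : ℂ) ≠ 0 := by
  have e : ((1 - (ζ : ℂ).re : ℝ) : ℂ) = -((ζ : ℂ) - 1) ^ 2 / (2 * ζ) := by
    have := ζ.coe_ne_zero
    push_cast
    rw [Circle.coe_re_eq]
    field_simp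
    ring
  rw [e]
  exact div_ne_zero (neg_ne_zero.2 (pow_ne_zero 2 (sub_ne_zero.2 h)))
    (mul_ne_zero two_ne_zero ζ.coe_ne_zero)

lemma Circle.half_le_norm_one_sub_mul (ζ : Circle) {w : ℂ} (hw : ‖w‖ ≤ 1 / 2) :
    1 / 2 ≤ ‖1 - (ζ : ℂ) * w‖ := by
  have h := norm_sub_norm_le (1 : ℂ) ((ζ : ℂ) * w)
  rw [norm_mul, ζ.norm_coe, norm_one, one_mul] at h
  linarith

lemma Circle.one_sub_mul_ne_zero (ζ : Circle) {w : ℂ} (hw : ‖w‖ < 1) :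
    1 - (ζ : ℂ) * w ≠ 0 := by
  intro h
  have h1 : ‖(ζ : ℂ) * w‖ = 1 := by rw [← sub_eq_zero.1 h, norm_one]
  rw [norm_mul, ζ.norm_coe, one_mul] at h1
  linarith

/-- The Herglotz integral of the measure `(1 - Re ζ) dμ(ζ)`. -/
def herglotzWeighted (μ : Measure Circle) (w : ℂ) : ℂ :=
  ∫ ζ : Circle, (1 + (ζ : ℂ) * w) / (1 - (ζ : ℂ) * w) * ((1 - (ζ : ℂ).re : ℝ) : ℂ) ∂μ

lemma norm_integral_mul_one_sub_re_le (μ : Measure Circle) [IsProbabilityMeasure μ]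
    {f : Circle → ℂ} {C : ℝ} (hf : ∀ ζ, ‖f ζ‖ ≤ C) :
    ‖∫ ζ : Circle, f ζ * ((1 - (ζ : ℂ).re : ℝ) : ℂ) ∂μ‖
      ≤ C * ∫ ζ : Circle, (1 - (ζ : ℂ).re) ∂μ := by
  rw [← integral_const_mul]
  refine norm_integral_le_of_norm_le
    (Circle.integrable_of_continuous μ (by fun_prop)) (Eventually.of_forall fun ζ => ?_)
  rw [norm_mul, norm_real, Real.norm_of_nonneg ζ.one_sub_re_nonneg]
  exact mul_le_mul_of_nonneg_right (hf ζ) ζ.one_sub_re_nonneg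

lemma Circle.continuous_div_one_sub_mul {f : Circle → ℂ} (hf : Continuous f) {w : ℂ}
    (hw : ‖w‖ < 1) : Continuous fun ζ : Circle => f ζ / (1 - (ζ : ℂ) * w) :=
  hf.div (by fun_prop) fun ζ => ζ.one_sub_mul_ne_zero hw

lemma norm_herglotzWeighted_le (μ : Measure Circle) [IsProbabilityMeasure μ] {w : ℂ}
    (hw : ‖w‖ ≤ 1 / 2) :
    ‖herglotzWeighted μ w‖ ≤ 3 * ∫ ζ : Circle, (1 - (ζ : ℂ).re) ∂μ := by
  refine norm_integral_mul_one_sub_re_le μ fun ζ => ?_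
  have h1 := ζ.half_le_norm_one_sub_mul hw
  rw [norm_div, div_le_iff₀ (by linarith)]
  have h2 := norm_add_le (1 : ℂ) ((ζ : ℂ) * w)
  rw [norm_mul, ζ.norm_coe, norm_one, one_mul] at h2
  linarith

lemma norm_herglotzWeighted_sub_le (μ : Measure Circle) [IsProbabilityMeasure μ] {w z : ℂ}
    (hw : ‖w‖ ≤ 1 / 2) (hz : ‖z‖ ≤ 1 / 2) :
    ‖herglotzWeighted μ w - herglotzWeighted μ z‖
      ≤ 8 * ‖w - z‖ * ∫ ζ : Circle, (1 - (ζ : ℂ).re) ∂μ := by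
  have hint : ∀ v : ℂ, ‖v‖ ≤ 1 / 2 → Integrable (fun ζ : Circle =>
      (1 + (ζ : ℂ) * v) / (1 - (ζ : ℂ) * v) * ((1 - (ζ : ℂ).re : ℝ) : ℂ)) μ := fun v hv =>
    Circle.integrable_of_continuous μ
      ((Circle.continuous_div_one_sub_mul (by fun_prop) (by linarith)).mul (by fun_prop))
  rw [herglotzWeighted, herglotzWeighted, ← integral_sub (hint w hw) (hint z hz)]
  simp_rw [← sub_mul]
  refine norm_integral_mul_one_sub_re_le μ fun ζ => ?_
  have h1 := ζ.half_le_norm_one_sub_mul hw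
  have h2 := ζ.half_le_norm_one_sub_mul hz
  have n1 := ζ.one_sub_mul_ne_zero (hw.trans_lt (by norm_num))
  have n2 := ζ.one_sub_mul_ne_zero (hz.trans_lt (by norm_num))
  have e : (1 + (ζ : ℂ) * w) / (1 - (ζ : ℂ) * w) - (1 + (ζ : ℂ) * z) / (1 - (ζ : ℂ) * z)
      = 2 * ζ * (w - z) / ((1 - (ζ : ℂ) * w) * (1 - (ζ : ℂ) * z)) := by
    field_simp
    ring
  rw [e, norm_div, norm_mul, norm_mul, norm_mul, ζ.norm_coe, RCLike.norm_ofNat, mul_one,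
    div_le_iff₀ (by positivity)]
  have h3 : 1 / 2 * (1 / 2) ≤ ‖1 - (ζ : ℂ) * w‖ * ‖1 - (ζ : ℂ) * z‖ := by gcongr
  nlinarith [norm_nonneg (w - z)]

/-- First-order expansion of the B-transform of a measure with real first moment. -/
lemma norm_BT_sub_one_add_le (μ : Measure Circle) [IsProbabilityMeasure μ]
    (him : ∫ ζ : Circle, (ζ : ℂ).im ∂μ = 0) {w : ℂ} (hw : ‖w‖ ≤ 1 / 2)
    (hs : ∫ ζ : Circle, (1 - (ζ : ℂ).re) ∂μ ≤ 1 / 6) :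
    ‖BT μ w - 1 + herglotzWeighted μ w‖ ≤ 18 * (∫ ζ : Circle, (1 - (ζ : ℂ).re) ∂μ) ^ 2 := by
  set s := ∫ ζ : Circle, (1 - (ζ : ℂ).re) ∂μ
  have hs0 : 0 ≤ s := integral_nonneg fun ζ => ζ.one_sub_re_nonneg
  have hw1 : ‖w‖ < 1 := by linarith
  have hP := norm_herglotzWeighted_le μ hw
  change _ ≤ 3 * s at hP
  set P := herglotzWeighted μ w with hPdef
  set D : ℂ := ∫ ζ : Circle, 1 / (1 - (ζ : ℂ) * w) ∂μ with hD
  set N : ℂ := ∫ ζ : Circle, (ζ : ℂ) / (1 - (ζ : ℂ) * w) ∂μ with hN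
  have iD : Integrable (fun ζ : Circle => 1 / (1 - (ζ : ℂ) * w)) μ :=
    Circle.integrable_of_continuous μ (Circle.continuous_div_one_sub_mul (by fun_prop) hw1)
  have iN : Integrable (fun ζ : Circle => (ζ : ℂ) / (1 - (ζ : ℂ) * w)) μ :=
    Circle.integrable_of_continuous μ (Circle.continuous_div_one_sub_mul (by fun_prop) hw1)
  have hpsi : psiT μ w = w * N := by
    rw [psiT, hN, ← integral_const_mul]
    refine integral_congr_ae (Eventually.of_forall fun ζ => ?_)
    simp only
    ring
  have hDN : D = 1 + w * N := by
    have : ∫ ζ : Circle, (1 / (1 - (ζ : ℂ) * w) - w * ((ζ : ℂ) / (1 - (ζ : ℂ) * w))) ∂μ = 1 := by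
      have : ∀ ζ : Circle, 1 / (1 - (ζ : ℂ) * w) - w * ((ζ : ℂ) / (1 - (ζ : ℂ) * w)) = 1 := by
        intro ζ
        have := ζ.one_sub_mul_ne_zero hw1
        field_simp
      rw [integral_congr_ae (Eventually.of_forall this)]
      simp
    rw [integral_sub iD (iN.const_mul w), integral_const_mul] at this
    linear_combination this
  have hBT : BT μ w = N / D := by
    rw [BT]
    split_ifs with h0
    · simp [hDN, hN, h0]
    · rw [hpsi, hDN]
      field_simp
  have hPQ : P = (1 - w) * (D - N) := by
    have e1 : ∀ ζ : Circle, (1 + (ζ : ℂ) * w) / (1 - (ζ : ℂ) * w) * ((1 - (ζ : ℂ).re : ℝ) : ℂ)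
        = (1 - w) * (1 / (1 - (ζ : ℂ) * w) - (ζ : ℂ) / (1 - (ζ : ℂ) * w))
          + I * ((ζ : ℂ).im : ℂ) := by
      intro ζ
      have n1 := ζ.one_sub_mul_ne_zero hw1
      have n2 := ζ.coe_ne_zero
      push_cast
      rw [Circle.coe_re_eq, Circle.I_mul_im_eq]
      field_simp
      ring
    rw [hPdef, herglotzWeighted]
    simp_rw [e1]
    have i1 : Integrable (fun ζ : Circle =>
        (1 - w) * (1 / (1 - (ζ : ℂ) * w) - (ζ : ℂ) / (1 - (ζ : ℂ) * w))) μ :=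
      (iD.sub iN).const_mul _
    have i2 : Integrable (fun ζ : Circle => I * ((ζ : ℂ).im : ℂ)) μ :=
      Circle.integrable_of_continuous μ (by fun_prop)
    rw [integral_add i1 i2, integral_const_mul, integral_const_mul, integral_sub iD iN,
      integral_complex_ofReal, him, ofReal_zero, mul_zero, add_zero]
  have n1 : 1 - w ≠ 0 := by
    intro h
    rw [← sub_eq_zero.1 h, norm_one] at hw1
    exact lt_irrefl _ hw1
  have hnw : 1 / 2 ≤ ‖1 - w‖ := by
    simpa using (1 : Circle).half_le_norm_one_sub_mul hw
  set Q := D - N with hQ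
  have hQle : ‖Q‖ ≤ 6 * s := by
    rw [hPQ, norm_mul] at hP
    nlinarith [norm_nonneg Q]
  have hwQ : ‖w * Q‖ ≤ 3 * s := by
    rw [norm_mul]
    calc ‖w‖ * ‖Q‖ ≤ 1 / 2 * (6 * s) := by gcongr
      _ = 3 * s := by ring
  have hden : 1 / 2 ≤ ‖1 - w * Q‖ := by
    have h := norm_sub_norm_le (1 : ℂ) (w * Q)
    rw [norm_one] at h
    linarith
  have n2 : 1 - w * Q ≠ 0 := by
    intro h
    rw [h, norm_zero] at hden
    norm_num at hden
  have hD1 : (1 - w) * D = 1 - w * Q := by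
    linear_combination hDN - w * hQ
  have n3 : D ≠ 0 := by
    rintro h
    rw [h, mul_zero] at hD1
    exact n2 hD1.symm
  have hmain : BT μ w - 1 + P = -(P * (w * Q)) / (1 - w * Q) := by
    have e : N / D * D = N := div_mul_cancel₀ N n3
    rw [hBT, ← hD1, eq_div_iff (mul_ne_zero n1 n3)]
    linear_combination (1 - w) * e + P * hD1 + hPQ + (1 - w) * hQ
  rw [hmain, norm_div, norm_neg, norm_mul, div_le_iff₀ (by linarith)]
  calc ‖P‖ * ‖w * Q‖ ≤ 3 * s * (3 * s) := by gcongr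
    _ = 18 * s ^ 2 * (1 / 2) := by ring
    _ ≤ _ := by gcongr

/-- Power series expansion of a weighted Herglotz integral. -/
lemma hasSum_herglotz (μ : Measure Circle) [IsFiniteMeasure μ] {g : Circle → ℂ}
    (hg : Continuous g) {x : ℂ} (hx : ‖x‖ < 1) :
    HasSum (fun k : ℕ => ((if k = 0 then 1 else 2) * ∫ ζ : Circle, (ζ : ℂ) ^ k * g ζ ∂μ) * x ^ k)
      (∫ ζ : Circle, (1 + (ζ : ℂ) * x) / (1 - (ζ : ℂ) * x) * g ζ ∂μ) := by
  have hpt : ∀ ζ : Circle, HasSum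
      (fun k : ℕ => (if k = 0 then 1 else 2) * ((ζ : ℂ) ^ k * g ζ) * x ^ k)
      ((1 + (ζ : ℂ) * x) / (1 - (ζ : ℂ) * x) * g ζ) := by
    intro ζ
    have n1 := ζ.one_sub_mul_ne_zero hx
    have h1 : HasSum (fun k : ℕ => ((ζ : ℂ) * x) ^ k) (1 - (ζ : ℂ) * x)⁻¹ :=
      hasSum_geometric_of_norm_lt_one (by rwa [norm_mul, ζ.norm_coe, one_mul])
    have h2 := ((h1.mul_left 2).sub (hasSum_ite_eq (0 : ℕ) (1 : ℂ))).mul_right (g ζ)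
    have e1 : (1 + (ζ : ℂ) * x) / (1 - (ζ : ℂ) * x) * g ζ
        = (2 * (1 - (ζ : ℂ) * x)⁻¹ - 1) * g ζ := by
      field_simp
      ring
    rw [e1]
    refine h2.congr_fun fun k => ?_
    rcases eq_or_ne k 0 with rfl | hk
    · simp only [if_true, pow_zero]
      ring
    · simp only [hk, if_false, mul_pow]
      ring
  obtain ⟨C, hC⟩ := isCompact_univ.exists_bound_of_continuousOn hg.continuousOn
  have hcont : ∀ k : ℕ, Continuous fun ζ : Circle =>
      (if k = 0 then 1 else 2) * ((ζ : ℂ) ^ k * g ζ) * x ^ k := fun k => by fun_prop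
  have hsum := hasSum_integral_of_summable_integral_norm (μ := μ)
    (F := fun (k : ℕ) (ζ : Circle) => (if k = 0 then 1 else 2) * ((ζ : ℂ) ^ k * g ζ) * x ^ k)
    (fun k => Circle.integrable_of_continuous μ (hcont k)) ?_
  · simp_rw [integral_mul_const, integral_const_mul] at hsum
    rw [integral_congr_ae (Eventually.of_forall fun ζ => (hpt ζ).tsum_eq)] at hsum
    exact hsum
  · refine Summable.of_nonneg_of_le (fun k => integral_nonneg fun ζ => norm_nonneg _)
      (fun k => ?_) ((summable_geometric_of_lt_one (norm_nonneg x) hx).mul_left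
        (μ.real Set.univ * (2 * C)))
    have hb : ∀ ζ : Circle, ‖(if k = 0 then 1 else 2) * ((ζ : ℂ) ^ k * g ζ) * x ^ k‖
        ≤ 2 * C * ‖x‖ ^ k := by
      intro ζ
      rw [norm_mul, norm_mul, norm_mul, norm_pow, norm_pow, ζ.norm_coe, one_pow, one_mul]
      have h1 : ‖(if k = 0 then 1 else 2 : ℂ)‖ ≤ 2 := by split_ifs <;> simp
      gcongr
      exact hC ζ (Set.mem_univ ζ)
    calc _ ≤ ∫ ζ : Circle, 2 * C * ‖x‖ ^ k ∂μ :=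
          integral_mono (Circle.integrable_of_continuous μ (hcont k).norm)
            (integrable_const _) hb
      _ = _ := by rw [integral_const, smul_eq_mul]; ring

lemma Kp_natCast_eq (p : ℕ) (ζ : Circle) :
    Kp p ζ = -∑ j ∈ Finset.range p, (2 * ∑ k ∈ Finset.range (j + 1), (ζ : ℂ) ^ k - 1) := by
  have n0 := ζ.coe_ne_zero
  rw [Kp]
  split_ifs with h
  · simp only [h, one_pow, Finset.sum_const, Finset.card_range, nsmul_eq_mul, mul_one]
    push_cast
    congr 1
    induction p with
    | zero => simp
    | succ p ih =>
      rw [Finset.sum_range_succ, ← ih]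
      push_cast
      ring
  · rw [div_eq_iff (Circle.one_sub_re_ne_zero h)]
    have hstep : ∀ j : ℕ, (ζ : ℂ) ^ (j + 1) - (ζ : ℂ) ^ j - I * ((ζ : ℂ).im : ℂ) =
        -(2 * ∑ k ∈ Finset.range (j + 1), (ζ : ℂ) ^ k - 1) * ((1 - (ζ : ℂ).re : ℝ) : ℂ) := by
      intro j
      push_cast
      rw [Circle.coe_re_eq, Circle.I_mul_im_eq]
      induction j with
      | zero => simp; ring
      | succ j ih =>
        rw [Finset.sum_range_succ]
        have e : (ζ : ℂ) ^ (j + 1 + 1) - (ζ : ℂ) ^ (j + 1) =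
            ((ζ : ℂ) ^ (j + 1) - (ζ : ℂ) ^ j)
              - 2 * (ζ : ℂ) ^ (j + 1) * (1 - ((ζ : ℂ) + (ζ : ℂ)⁻¹) / 2) := by
          field_simp
          ring
        linear_combination ih + e
    rw [zpow_natCast]
    induction p with
    | zero => simp
    | succ p ih =>
      rw [Finset.sum_range_succ]
      push_cast at ih ⊢
      have := hstep p
      push_cast at this
      linear_combination ih + this

lemma continuous_Kp_natCast (p : ℕ) : Continuous (Kp p) := by
  rw [funext (Kp_natCast_eq p)]
  fun_prop

lemma Kp_neg (p : ℤ) (ζ : Circle) : Kp (-p) ζ = (starRingEnd ℂ) (Kp p ζ) := by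
  rw [Kp, Kp]
  split_ifs with h
  · simp
  · simp only [map_div₀, map_sub, map_mul, map_zpow₀, map_one, conj_I, conj_ofReal, map_intCast,
      ← Circle.coe_inv_eq_conj, Circle.coe_inv, inv_zpow, zpow_neg]
    push_cast
    ring

lemma zpow_sub_one_sub_eq_Kp_mul (p : ℤ) (ζ : Circle) :
    (ζ : ℂ) ^ p - 1 - I * p * ((ζ : ℂ).im : ℂ) = Kp p ζ * ((1 - (ζ : ℂ).re : ℝ) : ℂ) := by
  rw [Kp]
  split_ifs with h
  · simp [h]
  · rw [div_mul_cancel₀ _ (Circle.one_sub_re_ne_zero h)]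

/-- Rotating a probability measure on the circle so that its first moment becomes nonnegative. -/
lemma exists_centering (μ : Measure Circle) [IsProbabilityMeasure μ] :
    ∃ (b : Circle) (m : Measure Circle), IsProbabilityMeasure m ∧
      ∫ ζ : Circle, (ζ : ℂ).im ∂m = 0 ∧
      ‖(b : ℂ) - 1‖ ≤ 2 * ‖(∫ ζ : Circle, (ζ : ℂ) ∂μ) - 1‖ ∧
      ∫ ζ : Circle, (1 - (ζ : ℂ).re) ∂m ≤ ‖(∫ ζ : Circle, (ζ : ℂ) ∂μ) - 1‖ ∧
      (∀ p : ℤ, ∫ ζ : Circle, (ζ : ℂ) ^ p ∂μ = (b : ℂ) ^ p * ∫ ζ : Circle, (ζ : ℂ) ^ p ∂m) ∧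
      ∀ z : ℂ, BT μ z = b * BT m (b * z) := by
  set c := ∫ ζ : Circle, (ζ : ℂ) ∂μ with hc
  obtain ⟨b, hb⟩ : ∃ b : Circle, c = ‖c‖ * b :=
    ⟨Circle.exp (arg c), by rw [Circle.coe_exp, norm_mul_exp_arg_mul_I]⟩
  have hb0 := b.coe_ne_zero
  have hmeas : Measurable fun ζ : Circle => b⁻¹ * ζ := by fun_prop
  have htr : ∀ f : Circle → ℂ, ∫ ζ, f ζ ∂(μ.map fun ζ => b⁻¹ * ζ) = ∫ ζ, f (b⁻¹ * ζ) ∂μ :=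
    fun f => (Homeomorph.mulLeft b⁻¹).measurableEmbedding.integral_map f
  have hprob : IsProbabilityMeasure (μ.map fun ζ => b⁻¹ * ζ) :=
    Measure.isProbabilityMeasure_map hmeas.aemeasurable
  have hmom : ∫ ζ : Circle, (ζ : ℂ) ∂(μ.map fun ζ => b⁻¹ * ζ) = ‖c‖ := by
    rw [htr]
    simp_rw [Circle.coe_mul]
    rw [integral_const_mul, ← hc, Circle.coe_inv, inv_mul_eq_iff_eq_mul₀ hb0, mul_comm]
    exact hb
  have hint : Integrable (fun ζ : Circle => (ζ : ℂ)) (μ.map fun ζ => b⁻¹ * ζ) :=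
    Circle.integrable_of_continuous _ (by fun_prop)
  have hre : ∫ ζ : Circle, (ζ : ℂ).re ∂(μ.map fun ζ => b⁻¹ * ζ) = ‖c‖ := by
    have := integral_re hint
    rw [hmom] at this
    simpa using this
  have him : ∫ ζ : Circle, (ζ : ℂ).im ∂(μ.map fun ζ => b⁻¹ * ζ) = 0 := by
    have := integral_im hint
    rw [hmom] at this
    simpa using this
  have hc1 : 1 - ‖c‖ ≤ ‖c - 1‖ := by
    have := norm_sub_norm_le 1 c
    rwa [norm_one, norm_sub_rev] at this
  have hcle : ‖c‖ ≤ 1 := by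
    have := norm_integral_le_of_norm_le_const (μ := μ) (C := 1)
      (Eventually.of_forall fun ζ : Circle => ζ.norm_coe.le)
    simpa using this
  refine ⟨b, _, hprob, him, ?_, ?_, fun p => ?_, fun z => ?_⟩
  · have e : (b : ℂ) - 1 = (1 - ‖c‖ : ℝ) * b + (c - 1) := by
      push_cast
      linear_combination -hb
    calc ‖(b : ℂ) - 1‖ ≤ ‖((1 - ‖c‖ : ℝ) : ℂ) * b‖ + ‖c - 1‖ := by
          rw [e]; exact norm_add_le _ _
      _ = (1 - ‖c‖) + ‖c - 1‖ := by
          rw [norm_mul, b.norm_coe, norm_real, Real.norm_of_nonneg (by linarith), mul_one]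
      _ ≤ _ := by linarith
  · rw [integral_sub (integrable_const _) (Circle.integrable_of_continuous _ (by fun_prop)), hre]
    simpa using hc1
  · rw [htr, ← integral_const_mul]
    refine integral_congr_ae (Eventually.of_forall fun ζ => ?_)
    simp only [Circle.coe_mul, mul_zpow, Circle.coe_inv]
    rw [← mul_assoc, ← mul_zpow, mul_inv_cancel₀ hb0, one_zpow, one_mul]
  · have hpsi : psiT (μ.map fun ζ => b⁻¹ * ζ) (b * z) = psiT μ z := by
      rw [psiT, htr, psiT]
      refine integral_congr_ae (Eventually.of_forall fun ζ => ?_)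
      have : ((b⁻¹ * ζ : Circle) : ℂ) * (b * z) = ζ * z := by
        rw [Circle.coe_mul, Circle.coe_inv]
        field_simp
      simp only [this]
    rw [BT, BT]
    rcases eq_or_ne z 0 with rfl | hz
    · simp only [mul_zero, if_true]
      rw [← hc, hmom, mul_comm]
      exact hb
    · rw [if_neg hz, if_neg (mul_ne_zero hb0 hz), hpsi]
      field_simp

lemma IsInfinitesimalArrayT.eventually_norm_moment_sub_one_le {kn : ℕ → ℕ}
    {μ : ℕ → ℕ → Measure Circle} (hinf : IsInfinitesimalArrayT kn μ)
    (hprob : ∀ n i, IsProbabilityMeasure (μ n i)) {ε : ℝ} (hε : 0 < ε) :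
    ∀ᶠ n in atTop, ∀ i < kn n, ‖(∫ ζ : Circle, (ζ : ℂ) ∂(μ n i)) - 1‖ ≤ ε := by
  obtain ⟨N, hN⟩ := hinf (ε / 2) (by positivity) (ENNReal.ofReal (ε / 4)) (by simpa using hε)
  filter_upwards [eventually_ge_atTop N] with n hn i hi
  have := hprob n i
  set A := {ζ : Circle | ε / 2 ≤ ‖(ζ : ℂ) - 1‖} with hA
  have hAm : MeasurableSet A := measurableSet_le measurable_const (by fun_prop)
  have hAle : (μ n i).real A ≤ ε / 4 :=
    ENNReal.toReal_le_of_le_ofReal (by positivity) (hN n hn i hi).le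
  have e : (∫ ζ : Circle, (ζ : ℂ) ∂(μ n i)) - 1 = ∫ ζ : Circle, ((ζ : ℂ) - 1) ∂(μ n i) := by
    rw [integral_sub (Circle.integrable_of_continuous _ (by fun_prop)) (integrable_const _)]
    simp
  have hI : Integrable (fun ζ : Circle => ε / 2 + A.indicator (fun _ => (2 : ℝ)) ζ) (μ n i) :=
    (integrable_const _).add ((integrable_const _).indicator hAm)
  rw [e]
  calc _ ≤ ∫ ζ : Circle, (ε / 2 + A.indicator (fun _ => (2 : ℝ)) ζ) ∂(μ n i) := by
        refine norm_integral_le_of_norm_le hI (Eventually.of_forall fun ζ => ?_)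
        by_cases h : ζ ∈ A
        · rw [Set.indicator_of_mem h]
          have : ‖(ζ : ℂ) - 1‖ ≤ ‖(ζ : ℂ)‖ + ‖(1 : ℂ)‖ := norm_sub_le _ _
          rw [ζ.norm_coe, norm_one] at this
          linarith
        · rw [Set.indicator_of_notMem h]
          have : ‖(ζ : ℂ) - 1‖ < ε / 2 := not_le.1 h
          linarith
    _ = ε / 2 + (μ n i).real A * 2 := by
        rw [integral_add (integrable_const _) ((integrable_const _).indicator hAm),
          integral_indicator_const _ hAm]
        simp
    _ ≤ ε := by linarith

lemma norm_herglotz_sub_mass_le (σ : Measure Circle) [IsFiniteMeasure σ] {z : ℂ}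
    (hz : ‖z‖ ≤ 1 / 2) :
    ‖(∫ ζ : Circle, (1 + (ζ : ℂ) * z) / (1 - (ζ : ℂ) * z) ∂σ) - (σ.real Set.univ : ℂ)‖
      ≤ 4 * ‖z‖ * σ.real Set.univ := by
  have e : (σ.real Set.univ : ℂ) = ∫ _ : Circle, (1 : ℂ) ∂σ := by simp
  rw [e, ← integral_sub (Circle.integrable_of_continuous σ
    (Circle.continuous_div_one_sub_mul (by fun_prop) (by linarith))) (integrable_const _)]
  refine norm_integral_le_of_norm_le_const (Eventually.of_forall fun ζ => ?_)
  have n1 := ζ.one_sub_mul_ne_zero (hz.trans_lt (by norm_num))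
  have h1 := ζ.half_le_norm_one_sub_mul hz
  have e1 : (1 + (ζ : ℂ) * z) / (1 - (ζ : ℂ) * z) - 1 = 2 * (ζ * z) / (1 - (ζ : ℂ) * z) := by
    field_simp
    ring
  rw [e1, norm_div, norm_mul, norm_mul, ζ.norm_coe, RCLike.norm_ofNat, one_mul,
    div_le_iff₀ (by linarith)]
  nlinarith [norm_nonneg z]

lemma herglotzWeighted_zero (μ : Measure Circle) :
    herglotzWeighted μ 0 = ((∫ ζ : Circle, (1 - (ζ : ℂ).re) ∂μ : ℝ) : ℂ) := by
  rw [herglotzWeighted, ← integral_complex_ofReal]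
  simp

lemma BT_zero_eq (μ : Measure Circle) [IsProbabilityMeasure μ]
    (him : ∫ ζ : Circle, (ζ : ℂ).im ∂μ = 0) :
    BT μ 0 = ((1 - ∫ ζ : Circle, (1 - (ζ : ℂ).re) ∂μ : ℝ) : ℂ) := by
  have hint : Integrable (fun ζ : Circle => (ζ : ℂ)) μ :=
    Circle.integrable_of_continuous _ (by fun_prop)
  have hre : Integrable (fun ζ : Circle => (ζ : ℂ).re) μ :=
    Circle.integrable_of_continuous _ (by fun_prop)
  rw [BT, if_pos rfl, integral_sub (integrable_const _) hre]
  have h1 := integral_re hint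
  have h2 := integral_im hint
  apply Complex.ext
  · simpa using h1.symm
  · rw [ofReal_im, ← him]
    exact h2.symm

/-- For a centered infinitesimal array, convergence of the products of B-transforms forces
convergence of the rotations and of the moments of the row sums of `(1 - Re ζ) dμ`. -/
lemma tendsto_rotation_and_moments (kn : ℕ → ℕ) (m : ℕ → ℕ → Measure Circle)
    (hm : ∀ n i, IsProbabilityMeasure (m n i)) (b : ℕ → ℕ → Circle)
    (him : ∀ n i, ∫ ζ : Circle, (ζ : ℂ).im ∂(m n i) = 0)
    (hs : ∀ ε > 0, ∀ᶠ n in atTop, ∀ i < kn n, ∫ ζ : Circle, (1 - (ζ : ℂ).re) ∂(m n i) ≤ ε)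
    (hb : ∀ ε > 0, ∀ᶠ n in atTop, ∀ i < kn n, ‖(b n i : ℂ) - 1‖ ≤ ε)
    (lam : ℕ → Circle) (γ : Circle) (σ : Measure Circle) [IsFiniteMeasure σ]
    (hconv : ∀ z : ℂ, ‖z‖ ≤ 1 / 2 → Tendsto (fun n => (lam n : ℂ) *
      ∏ i ∈ Finset.range (kn n), ((b n i : ℂ) * BT (m n i) (b n i * z))) atTop (𝓝 (BID γ σ z))) :
    Tendsto (fun n => (lam n : ℂ) * ∏ i ∈ Finset.range (kn n), (b n i : ℂ)) atTop (𝓝 γ) ∧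
    (∃ M, ∀ᶠ n in atTop,
      ∑ i ∈ Finset.range (kn n), ∫ ζ : Circle, (1 - (ζ : ℂ).re) ∂(m n i) ≤ M) ∧
    ∀ k : ℕ, Tendsto (fun n => ∑ i ∈ Finset.range (kn n),
      ∫ ζ : Circle, (ζ : ℂ) ^ k * ((1 - (ζ : ℂ).re : ℝ) : ℂ) ∂(m n i)) atTop
      (𝓝 (∫ ζ : Circle, (ζ : ℂ) ^ k ∂σ)) := by
  set S : ℝ := σ.real Set.univ with hS
  have hS0 : 0 ≤ S := measureReal_nonneg
  set s : ℕ → ℕ → ℝ := fun n i => ∫ ζ : Circle, (1 - (ζ : ℂ).re) ∂(m n i) with hs_def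
  have hs0 : ∀ n i, 0 ≤ s n i := fun n i => integral_nonneg fun ζ => ζ.one_sub_re_nonneg
  set L : ℕ → ℂ := fun n => (lam n : ℂ) * ∏ i ∈ Finset.range (kn n), (b n i : ℂ) with hL
  have hL1 : ∀ n, ‖L n‖ = 1 := fun n => by
    simp only [hL, norm_mul, norm_prod, Circle.norm_coe, Finset.prod_const_one, mul_one]
  have hL0 : ∀ n, L n ≠ 0 := fun n h => by
    have := hL1 n
    rw [h, norm_zero] at this
    norm_num at this
  set B : ℕ → ℂ → ℂ := fun n z => ∏ i ∈ Finset.range (kn n), BT (m n i) (b n i * z) with hB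
  set H : ℂ → ℂ := fun z => ∫ ζ : Circle, (1 + (ζ : ℂ) * z) / (1 - (ζ : ℂ) * z) ∂σ with hH
  set F : ℕ → ℂ → ℂ := fun n z => ∑ i ∈ Finset.range (kn n), herglotzWeighted (m n i) z with hF
  have hconv' : ∀ z : ℂ, ‖z‖ ≤ 1 / 2 →
      Tendsto (fun n => L n * B n z) atTop (𝓝 (γ * exp (-H z))) := by
    intro z hz
    refine (hconv z hz).congr fun n => ?_
    rw [hL, hB, Finset.prod_mul_distrib]
    ring
  have hH0 : H 0 = S := by simp [hH, hS]
  have hF0 : ∀ n, F n 0 = ((∑ i ∈ Finset.range (kn n), s n i : ℝ) : ℂ) := fun n => by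
    simp only [hF, herglotzWeighted_zero, ofReal_sum, hs_def]
  have hnB : Tendsto (fun n => ‖B n 0‖) atTop (𝓝 (Real.exp (-S))) := by
    have := (hconv' 0 (by norm_num)).norm
    simp only [norm_mul, hL1, one_mul, Circle.norm_coe, hH0, norm_exp] at this
    simpa using this
  have hM : ∀ᶠ n in atTop, ∑ i ∈ Finset.range (kn n), s n i ≤ S + 1 := by
    filter_upwards [hs 1 one_pos,
      hnB.eventually_const_lt (Real.exp_lt_exp.2 (show -(S + 1) < -S by linarith))] with n h1 h2
    have h3 : ‖B n 0‖ ≤ Real.exp (-∑ i ∈ Finset.range (kn n), s n i) := by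
      rw [hB, ← Finset.sum_neg_distrib, Real.exp_sum, norm_prod]
      refine Finset.prod_le_prod (fun i _ => norm_nonneg _) fun i hi => ?_
      have h4 : s n i ≤ 1 := h1 i (Finset.mem_range.1 hi)
      rw [mul_zero, BT_zero_eq _ (him n i), norm_real, Real.norm_of_nonneg (by linarith)]
      have := Real.add_one_le_exp (-s n i)
      linarith
    have h5 := Real.exp_lt_exp.1 (h2.trans_le h3)
    linarith
  have hBF : ∀ z : ℂ, ‖z‖ ≤ 1 / 2 → Tendsto (fun n => B n z * exp (F n z)) atTop (𝓝 1) := by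
    intro z hz
    have := tendsto_prod_mul_exp_neg_sum kn s (fun n i => BT (m n i) (b n i * z))
      (fun n i => -herglotzWeighted (m n i) z) (S + 1) 3 hs0 hs hM
      (fun n i => by rw [norm_neg]; exact norm_herglotzWeighted_le (m n i) hz) ?_
    · simpa only [Finset.sum_neg_distrib, neg_neg] using this
    intro ε hε
    filter_upwards [hs (1 / 6) (by norm_num), hs (ε / 36) (by positivity),
      hb (ε / 8) (by positivity)] with n h1 h2 h3 i hi
    have hw : ‖(b n i : ℂ) * z‖ ≤ 1 / 2 := by rwa [norm_mul, Circle.norm_coe, one_mul]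
    have e1 := norm_BT_sub_one_add_le (m n i) (him n i) hw (h1 i hi)
    have e2 := norm_herglotzWeighted_sub_le (m n i) hw hz
    change _ ≤ 18 * s n i ^ 2 at e1
    change _ ≤ _ * s n i at e2
    have e3 : ‖(b n i : ℂ) * z - z‖ ≤ ε / 8 * (1 / 2) := by
      rw [show (b n i : ℂ) * z - z = (b n i - 1) * z by ring, norm_mul]
      gcongr
      exact h3 i hi
    have e4 : 18 * s n i ^ 2 ≤ ε / 2 * s n i := by
      have : s n i * s n i ≤ ε / 36 * s n i := mul_le_mul_of_nonneg_right (h2 i hi) (hs0 n i)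
      nlinarith
    have e5 : 8 * ‖(b n i : ℂ) * z - z‖ * s n i ≤ ε / 2 * s n i :=
      mul_le_mul_of_nonneg_right (by linarith) (hs0 n i)
    calc ‖BT (m n i) (b n i * z) - 1 - -herglotzWeighted (m n i) z‖
        = ‖(BT (m n i) (b n i * z) - 1 + herglotzWeighted (m n i) (b n i * z))
          - (herglotzWeighted (m n i) (b n i * z) - herglotzWeighted (m n i) z)‖ := by
          congr 1; ring
      _ ≤ _ := norm_sub_le _ _
      _ ≤ ε * s n i := by linarith
  have hB0 : ∀ z : ℂ, ‖z‖ ≤ 1 / 2 → ∀ᶠ n in atTop, B n z ≠ 0 := by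
    intro z hz
    filter_upwards [(hconv' z hz).eventually_ne
      (mul_ne_zero γ.coe_ne_zero (exp_ne_zero _))] with n h h0
    rw [h0, mul_zero] at h
    exact h rfl
  have hsum : Tendsto (fun n => ∑ i ∈ Finset.range (kn n), s n i) atTop (𝓝 S) := by
    have h1 := (hBF 0 (by norm_num)).norm
    simp only [norm_mul, norm_exp, hF0, ofReal_re, norm_one] at h1
    have h2 := (h1.div hnB (Real.exp_ne_zero _)).log
      (div_ne_zero one_ne_zero (Real.exp_ne_zero _))
    have h3 : Real.log (1 / Real.exp (-S)) = S := by simp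
    rw [h3] at h2
    refine h2.congr' ?_
    filter_upwards [hB0 0 (by norm_num)] with n hn
    rw [Pi.div_apply, mul_div_cancel_left₀ _ (norm_ne_zero_iff.2 hn), Real.log_exp]
  have hF0' : Tendsto (fun n => F n 0) atTop (𝓝 S) := by
    simp only [hF0]
    exact (continuous_ofReal.tendsto S).comp hsum
  have hLγ : Tendsto L atTop (𝓝 γ) := by
    have h1 := ((hconv' 0 (by norm_num)).mul ((continuous_exp.tendsto _).comp hF0')).div
      (hBF 0 (by norm_num)) one_ne_zero
    rw [hH0, mul_assoc, ← exp_add, neg_add_cancel, exp_zero, mul_one, div_one] at h1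
    refine h1.congr' ?_
    filter_upwards [hB0 0 (by norm_num)] with n hn
    have := exp_ne_zero (F n 0)
    simp only [Pi.div_apply, Function.comp_apply]
    field_simp
  have hexp : ∀ z : ℂ, ‖z‖ ≤ 1 / 2 →
      Tendsto (fun n => exp (F n z - H z)) atTop (𝓝 1) := by
    intro z hz
    have h1 := ((hBF z hz).mul hLγ).div ((hconv' z hz).mul_const (exp (H z)))
      (by rw [mul_assoc, ← exp_add, neg_add_cancel, exp_zero, mul_one]; exact γ.coe_ne_zero)
    rw [mul_assoc, ← exp_add, neg_add_cancel, exp_zero, mul_one, one_mul,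
      div_self γ.coe_ne_zero] at h1
    refine h1.congr' ?_
    filter_upwards [hB0 z hz] with n hn
    have := exp_ne_zero (H z)
    have := hL0 n
    rw [Pi.div_apply, exp_sub]
    field_simp
  set r : ℝ := 1 / (8 * (S + 1)) with hr
  have hr0 : 0 < r := by positivity
  have hr1 : r ≤ 1 / 2 := by
    rw [hr]
    exact one_div_le_one_div_of_le (by norm_num) (by linarith)
  have hrS : 8 * r * (S + 1) = 1 := by
    rw [hr]
    field_simp
  have hFH : ∀ z : ℂ, ‖z‖ ≤ r → Tendsto (fun n => F n z - H z) atTop (𝓝 0) := by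
    intro z hz
    have hz2 := hz.trans hr1
    have h1 := (hexp z hz2).clog one_mem_slitPlane
    rw [log_one] at h1
    refine h1.congr' ?_
    filter_upwards [hM, Metric.tendsto_nhds.1 hF0' 1 one_pos] with n h2 h3
    rw [dist_eq_norm] at h3
    have a1 : ‖F n z - F n 0‖ ≤ 1 := by
      rw [hF, ← Finset.sum_sub_distrib]
      calc _ ≤ ∑ i ∈ Finset.range (kn n), 8 * r * s n i := norm_sum_le_of_le _ fun i _ => by
            refine (norm_herglotzWeighted_sub_le (m n i) hz2 (by norm_num)).trans ?_
            rw [sub_zero]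
            exact mul_le_mul_of_nonneg_right (by linarith) (hs0 n i)
        _ = 8 * r * ∑ i ∈ Finset.range (kn n), s n i := by rw [Finset.mul_sum]
        _ ≤ 8 * r * (S + 1) := by gcongr
        _ = 1 := hrS
    have a2 : ‖H z - S‖ ≤ 1 := by
      calc _ ≤ 4 * ‖z‖ * S := norm_herglotz_sub_mass_le σ hz2
        _ ≤ 8 * r * (S + 1) := by gcongr <;> linarith
        _ = 1 := hrS
    have a3 : ‖F n z - H z‖ ≤ 3 := by
      calc ‖F n z - H z‖ = ‖(F n z - F n 0) + (F n 0 - S) - (H z - S)‖ := by congr 1; ring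
        _ ≤ ‖F n z - F n 0‖ + ‖F n 0 - S‖ + ‖H z - S‖ :=
          (norm_sub_le _ _).trans (by gcongr; exact norm_add_le _ _)
        _ ≤ 3 := by linarith
    have a4 := abs_le.1 ((abs_im_le_norm _).trans a3)
    have := Real.pi_gt_three
    rw [log_exp (by linarith) (by linarith)]
  refine ⟨hLγ, ⟨S + 1, hM⟩, fun k => ?_⟩
  set c : ℕ → ℕ → ℂ := fun n k => ∑ i ∈ Finset.range (kn n),
    ∫ ζ : Circle, (ζ : ℂ) ^ k * ((1 - (ζ : ℂ).re : ℝ) : ℂ) ∂(m n i) with hc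
  have key := tendsto_coeff_of_tendsto_hasSum
    (fun n k => (if k = 0 then 1 else 2) * (c n k - ∫ ζ : Circle, (ζ : ℂ) ^ k ∂σ))
    (fun n x => F n x - H x) (2 * (S + 1 + S)) r hr0 hr1 ?_ ?_
    (fun x hx hxr => hFH x (by rw [norm_real, Real.norm_of_nonneg hx.le]; exact hxr.le)) k
  · have h1 := (key.const_mul (if k = 0 then 1 else 2 : ℂ)⁻¹).add_const
      (∫ ζ : Circle, (ζ : ℂ) ^ k ∂σ)
    rw [mul_zero, zero_add] at h1
    refine h1.congr fun n => ?_
    have : (if k = 0 then 1 else 2 : ℂ) ≠ 0 := by split_ifs <;> norm_num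
    field_simp
    ring
  · filter_upwards [hM] with n hn k
    have h1 : ‖(if k = 0 then 1 else 2 : ℂ)‖ ≤ 2 := by split_ifs <;> simp
    have h2 : ‖c n k‖ ≤ S + 1 := by
      refine le_trans (norm_sum_le_of_le _ fun i _ => ?_) hn
      have := norm_integral_mul_one_sub_re_le (m n i) (f := fun ζ : Circle => (ζ : ℂ) ^ k) (C := 1)
        fun ζ => by rw [norm_pow, ζ.norm_coe, one_pow]
      rwa [one_mul] at this
    have h3 : ‖∫ ζ : Circle, (ζ : ℂ) ^ k ∂σ‖ ≤ S := by
      have := norm_integral_le_of_norm_le_const (μ := σ) (C := 1)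
        (f := fun ζ : Circle => (ζ : ℂ) ^ k)
        (Eventually.of_forall fun ζ => by rw [norm_pow, ζ.norm_coe, one_pow])
      rwa [one_mul] at this
    rw [norm_mul]
    gcongr
    exact (norm_sub_le _ _).trans (add_le_add h2 h3)
  · intro n x hx hxr
    have hx1 : ‖(x : ℂ)‖ < 1 := by rw [norm_real, Real.norm_of_nonneg hx.le]; linarith
    have h1 := hasSum_sum (s := Finset.range (kn n)) fun i _ =>
      hasSum_herglotz (m n i) (g := fun ζ => ((1 - (ζ : ℂ).re : ℝ) : ℂ)) (by fun_prop) hx1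
    have h2 := h1.sub (hasSum_herglotz σ (g := fun _ => 1) continuous_const hx1)
    simp only [mul_one] at h2
    refine h2.congr_fun fun k => ?_
    rw [hc, ← Finset.sum_mul, ← Finset.mul_sum]
    ring

/-- The Fourier coefficients of nonnegative order of a centered array with convergent
moments. -/
lemma tendsto_prod_fourier_of_centered (kn : ℕ → ℕ) (m : ℕ → ℕ → Measure Circle)
    (hm : ∀ n i, IsProbabilityMeasure (m n i))
    (him : ∀ n i, ∫ ζ : Circle, (ζ : ℂ).im ∂(m n i) = 0)
    (hs : ∀ ε > 0, ∀ᶠ n in atTop, ∀ i < kn n, ∫ ζ : Circle, (1 - (ζ : ℂ).re) ∂(m n i) ≤ ε)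
    {M : ℝ} (hM : ∀ᶠ n in atTop,
      ∑ i ∈ Finset.range (kn n), ∫ ζ : Circle, (1 - (ζ : ℂ).re) ∂(m n i) ≤ M)
    (σ : Measure Circle) [IsFiniteMeasure σ]
    (hmom : ∀ k : ℕ, Tendsto (fun n => ∑ i ∈ Finset.range (kn n),
      ∫ ζ : Circle, (ζ : ℂ) ^ k * ((1 - (ζ : ℂ).re : ℝ) : ℂ) ∂(m n i)) atTop
      (𝓝 (∫ ζ : Circle, (ζ : ℂ) ^ k ∂σ))) (p : ℕ) :
    Tendsto (fun n => ∏ i ∈ Finset.range (kn n), ∫ ζ : Circle, (ζ : ℂ) ^ p ∂(m n i)) atTop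
      (𝓝 (exp (∫ ζ : Circle, Kp p ζ ∂σ))) := by
  have hcK := continuous_Kp_natCast p
  obtain ⟨C, hC⟩ := isCompact_univ.exists_bound_of_continuousOn hcK.continuousOn
  have hv : ∀ n i, (∫ ζ : Circle, (ζ : ℂ) ^ p ∂(m n i)) - 1 =
      ∫ ζ : Circle, Kp p ζ * ((1 - (ζ : ℂ).re : ℝ) : ℂ) ∂(m n i) := by
    intro n i
    have i1 : Integrable (fun ζ : Circle => (ζ : ℂ) ^ p - 1) (m n i) :=
      Circle.integrable_of_continuous _ (by fun_prop)
    have i2 : Integrable (fun ζ : Circle => I * p * ((ζ : ℂ).im : ℂ)) (m n i) :=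
      Circle.integrable_of_continuous _ (by fun_prop)
    have i3 : Integrable (fun ζ : Circle => (ζ : ℂ) ^ p) (m n i) :=
      Circle.integrable_of_continuous _ (by fun_prop)
    have e : ∀ ζ : Circle, Kp p ζ * ((1 - (ζ : ℂ).re : ℝ) : ℂ)
        = (ζ : ℂ) ^ p - 1 - I * p * ((ζ : ℂ).im : ℂ) := fun ζ => by
      rw [← zpow_sub_one_sub_eq_Kp_mul, zpow_natCast, Int.cast_natCast]
    rw [integral_congr_ae (Eventually.of_forall e), integral_sub i1 i2,
      integral_sub i3 (integrable_const _), integral_const_mul, integral_complex_ofReal, him]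
    simp
  have hprod := tendsto_prod_mul_exp_neg_sum kn
    (fun n i => ∫ ζ : Circle, (1 - (ζ : ℂ).re) ∂(m n i))
    (fun n i => ∫ ζ : Circle, (ζ : ℂ) ^ p ∂(m n i))
    (fun n i => ∫ ζ : Circle, Kp p ζ * ((1 - (ζ : ℂ).re : ℝ) : ℂ) ∂(m n i)) M C
    (fun n i => integral_nonneg fun ζ => ζ.one_sub_re_nonneg) hs hM
    (fun n i => norm_integral_mul_one_sub_re_le (m n i) fun ζ => hC ζ (Set.mem_univ ζ))
    (fun ε hε => Eventually.of_forall fun n i _ => by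
      rw [hv, sub_self, norm_zero]
      exact mul_nonneg hε.le (integral_nonneg fun ζ => ζ.one_sub_re_nonneg))
  have hexpand : ∀ (μ : Measure Circle) [IsFiniteMeasure μ] (g : Circle → ℂ), Continuous g →
      ∫ ζ : Circle, Kp p ζ * g ζ ∂μ = -∑ j ∈ Finset.range p,
        (2 * ∑ k ∈ Finset.range (j + 1), (∫ ζ : Circle, (ζ : ℂ) ^ k * g ζ ∂μ)
          - ∫ ζ : Circle, (ζ : ℂ) ^ 0 * g ζ ∂μ) := by
    intro μ _ g hg
    have hint : ∀ k : ℕ, Integrable (fun ζ : Circle => (ζ : ℂ) ^ k * g ζ) μ := fun k =>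
      Circle.integrable_of_continuous μ (by fun_prop)
    have hsumint : ∀ j : ℕ, Integrable (fun ζ : Circle =>
        2 * ∑ k ∈ Finset.range (j + 1), (ζ : ℂ) ^ k * g ζ) μ := fun j =>
      Circle.integrable_of_continuous μ (by fun_prop)
    have hdiff : ∀ j : ℕ, Integrable (fun ζ : Circle =>
        2 * ∑ k ∈ Finset.range (j + 1), (ζ : ℂ) ^ k * g ζ - (ζ : ℂ) ^ 0 * g ζ) μ := fun j =>
      (hsumint j).sub (hint 0)
    have e : ∀ ζ : Circle, Kp p ζ * g ζ = -∑ j ∈ Finset.range p,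
        (2 * ∑ k ∈ Finset.range (j + 1), (ζ : ℂ) ^ k * g ζ - (ζ : ℂ) ^ 0 * g ζ) := fun ζ => by
      rw [Kp_natCast_eq, neg_mul, Finset.sum_mul]
      congr 1
      refine Finset.sum_congr rfl fun j _ => ?_
      rw [← Finset.sum_mul]
      ring
    rw [integral_congr_ae (Eventually.of_forall e), integral_neg,
      integral_finsetSum _ fun j _ => hdiff j]
    congr 1
    refine Finset.sum_congr rfl fun j _ => ?_
    rw [integral_sub (hsumint j) (hint 0), integral_const_mul,
      integral_finsetSum _ fun k _ => hint k]
  have hsum : Tendsto (fun n => ∑ i ∈ Finset.range (kn n),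
      ∫ ζ : Circle, Kp p ζ * ((1 - (ζ : ℂ).re : ℝ) : ℂ) ∂(m n i)) atTop
      (𝓝 (∫ ζ : Circle, Kp p ζ ∂σ)) := by
    have hlim := (tendsto_finsetSum (Finset.range p) fun j _ =>
      ((tendsto_finsetSum (Finset.range (j + 1)) fun k _ => hmom k).const_mul 2).sub (hmom 0)).neg
    have e := hexpand σ (fun _ => 1) continuous_const
    simp only [mul_one] at e
    rw [e]
    refine hlim.congr fun n => ?_
    rw [Finset.sum_congr rfl fun i _ => hexpand (m n i) _ (by fun_prop),
      Finset.sum_neg_distrib, Finset.sum_comm]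
    congr 1
    refine Finset.sum_congr rfl fun j _ => ?_
    rw [Finset.sum_sub_distrib, ← Finset.mul_sum, Finset.sum_comm]
  have h := hprod.mul ((continuous_exp.tendsto _).comp hsum)
  rw [one_mul] at h
  refine h.congr fun n => ?_
  rw [Function.comp_apply, mul_assoc, ← exp_add, neg_add_cancel, exp_zero, mul_one]

/-- Theorem 4.1: if the boolean convolutions δ_{λ_n} ⨃ μ_{n1} ⨃ ⋯ ⨃ μ_{nk_n} converge weakly
to ν_⨃^{γ,σ}, then there is a probability measure ν on 𝕋 with Fourier coefficients
γ^p·exp(∫ K_p dσ), and the classical convolutions δ_{λ_n} ⊛ μ_{n1} ⊛ ⋯ ⊛ μ_{nk_n}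
converge weakly to ν: their p-th Fourier coefficients λ_n^p·Π_k ∫ζ^p dμ_{nk} converge to
γ^p·exp(∫ K_p dσ) for every p ∈ ℤ. -/
theorem stmt10
    (kn : ℕ → ℕ) (μ : ℕ → ℕ → Measure Circle)
    (hprob : ∀ n i, IsProbabilityMeasure (μ n i))
    (hinf : IsInfinitesimalArrayT kn μ)
    (hmom : ∀ n : ℕ, ∀ i < kn n, (∫ ζ : Circle, (ζ : ℂ) ∂(μ n i)) ≠ 0)
    (lam : ℕ → Circle)
    (γ : Circle) (σ : Measure Circle) (hσ : IsFiniteMeasure σ)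
    (hconv : ∀ K : Set ℂ, K ⊆ ball (0:ℂ) 1 → IsCompact K →
      TendstoUniformlyOn
        (fun n z => ((lam n : ℂ)) * ∏ i ∈ Finset.range (kn n), BT (μ n i) z)
        (BID γ σ) atTop K) :
    ∃ ν : Measure Circle, IsProbabilityMeasure ν ∧
      (∀ p : ℤ, (∫ ζ : Circle, (ζ : ℂ) ^ p ∂ν)
        = (γ : ℂ) ^ p * Complex.exp (∫ ζ : Circle, Kp p ζ ∂σ)) ∧
      (∀ p : ℤ, Tendsto
        (fun n => ((lam n : ℂ)) ^ p *
          ∏ i ∈ Finset.range (kn n), ∫ ζ : Circle, (ζ : ℂ) ^ p ∂(μ n i))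
        atTop (𝓝 ((γ : ℂ) ^ p * Complex.exp (∫ ζ : Circle, Kp p ζ ∂σ)))) := by
  choose b m hm him hb hs hmul hBT using fun n i => exists_centering (μ n i)
  have hmom1 : ∀ ε > 0, ∀ᶠ n in atTop, ∀ i < kn n,
      ‖(∫ ζ : Circle, (ζ : ℂ) ∂(μ n i)) - 1‖ ≤ ε := fun ε hε =>
    hinf.eventually_norm_moment_sub_one_le hprob hε
  have hs' : ∀ ε > 0, ∀ᶠ n in atTop, ∀ i < kn n,
      ∫ ζ : Circle, (1 - (ζ : ℂ).re) ∂(m n i) ≤ ε := fun ε hε => by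
    filter_upwards [hmom1 ε hε] with n h i hi
    exact (hs n i).trans (h i hi)
  have hb' : ∀ ε > 0, ∀ᶠ n in atTop, ∀ i < kn n, ‖(b n i : ℂ) - 1‖ ≤ ε := fun ε hε => by
    filter_upwards [hmom1 (ε / 2) (by positivity)] with n h i hi
    linarith [hb n i, h i hi]
  obtain ⟨hL, ⟨M, hM⟩, hmoments⟩ :=
    tendsto_rotation_and_moments kn m hm b him hs' hb' lam γ σ fun z hz => by
      have h := (hconv {z} (by simpa using hz.trans_lt (by norm_num))
        isCompact_singleton).tendsto_at (Set.mem_singleton z)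
      simpa only [hBT] using h
  have hnat : ∀ p : ℕ, Tendsto
      (fun n => ((lam n : ℂ)) ^ (p : ℤ) *
        ∏ i ∈ Finset.range (kn n), ∫ ζ : Circle, (ζ : ℂ) ^ (p : ℤ) ∂(μ n i))
      atTop (𝓝 ((γ : ℂ) ^ (p : ℤ) * Complex.exp (∫ ζ : Circle, Kp p ζ ∂σ))) := by
    intro p
    have h := (hL.pow p).mul (tendsto_prod_fourier_of_centered kn m hm him hs' hM σ hmoments p)
    rw [zpow_natCast]
    refine h.congr fun n => ?_
    simp only [hmul]
    simp only [zpow_natCast, Finset.prod_mul_distrib, Finset.prod_pow, mul_pow]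
    ring
  have hlim : ∀ p : ℤ, Tendsto
      (fun n => ((lam n : ℂ)) ^ p *
        ∏ i ∈ Finset.range (kn n), ∫ ζ : Circle, (ζ : ℂ) ^ p ∂(μ n i))
      atTop (𝓝 ((γ : ℂ) ^ p * Complex.exp (∫ ζ : Circle, Kp p ζ ∂σ))) := by
    intro p
    obtain ⟨q, rfl | rfl⟩ := p.eq_nat_or_neg
    · exact hnat q
    · have hz : ∀ ζ : Circle, (ζ : ℂ) ^ (-(q : ℤ)) = (starRingEnd ℂ) ((ζ : ℂ) ^ (q : ℤ)) := by
        intro ζ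
        rw [map_zpow₀, ← Circle.coe_inv_eq_conj, Circle.coe_inv, inv_zpow, zpow_neg]
      have h := (continuous_conj.tendsto _).comp (hnat q)
      simp only [hz, Kp_neg, integral_conj, exp_conj, ← map_prod, ← map_mul]
      exact h
  choose ρ hρ using fun n => exists_convolution_fourier (μ n) (hprob n) (lam n) (kn n)
  obtain ⟨ν, hν, hνp⟩ := exists_probability_of_tendsto_fourier ρ
    (fun p => (γ : ℂ) ^ p * Complex.exp (∫ ζ : Circle, Kp p ζ ∂σ))
    fun p => by simpa only [hρ] using hlim p
  exact ⟨ν, hν, hνp, hlim⟩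

end
end
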